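/- Suppose that for some field k and some monomial term order ⪯, the toric ideal I_Λ ⊆ k[z_1,…,z_n] has a Gröbner basis of degree d ≥ 2. Then for every λ ∈ Λ with deg(λ) > d, the geometric realization of the order complex Δ(0,λ) is nonempty and path-connected, and for every integer j with 1 ≤ j < −1 + (deg(λ) − 1)/(d − 1), the homotopy group π_j of the geometric realization of Δ(0,λ) is trivial; i.e. Δ(0,λ) is j-connected for every integer j < −1 + (deg(λ) − 1)/(d − 1). -/

import Mathlib

open scoped Classical

noncomputable section

namespace ASG

variable {e n : ℕ}

/-- Ambient monoid `ℕ^e`. -/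
abbrev M (e : ℕ) : Type := Fin e →₀ ℕ

/-- The affine semigroup `Λ` generated by `α 1, …, α n`. -/
def sg (α : Fin n → M e) : AddSubmonoid (M e) :=
  AddSubmonoid.closure (Set.range α)

/-- The partial order on `Λ` : `μ ≤ ν` iff `ν - μ ∈ Λ`. -/
def sgLE (α : Fin n → M e) (μ ν : M e) : Prop := ∃ δ ∈ sg α, μ + δ = ν

/-- Strict version of the order on `Λ`. -/
def sgLT (α : Fin n → M e) (μ ν : M e) : Prop := sgLE α μ ν ∧ μ ≠ ν

/-- `deg λ` : the least `r` such that `λ` is a sum of `r` generators. -/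
def deg (α : Fin n → M e) (l : M e) : ℕ :=
  sInf {r : ℕ | ∃ w : Fin r → Fin n, l = ∑ t, α (w t)}

/-- Comparability in the poset `Λ`. -/
def cmp2 (α : Fin n → M e) (a b : M e) : Prop := sgLE α a b ∨ sgLE α b a

/-- Faces of the order complex `Δ(x,y)` of the open interval `(x,y)` in `Λ`:
finite chains of elements strictly between `x` and `y`. -/
def IsOFace (α : Fin n → M e) (x y : M e) (S : Finset (M e)) : Prop :=
  (∀ μ ∈ S, μ ∈ sg α ∧ sgLT α x μ ∧ sgLT α μ y) ∧
    (S : Set (M e)).Pairwise (cmp2 α)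

/-- Faces with `m` vertices (i.e. of dimension `m - 1`). -/
def OFace (α : Fin n → M e) (x y : M e) (m : ℕ) : Type :=
  { S : Finset (M e) // IsOFace α x y S ∧ S.card = m }

/-- The simplicial chain group with coefficients in `K` spanned by the faces
with `m` vertices (the augmented/reduced chain complex: for `m = 0` this is a
copy of `K` spanned by the empty face). -/
abbrev OC (K : Type) [Field K] (α : Fin n → M e) (x y : M e) (m : ℕ) : Type :=
  OFace α x y m →₀ K

/-- Deleting a vertex from a face. -/
def erasedOFace {α : Fin n → M e} {x y : M e} {m : ℕ} (S : OFace α x y m)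
    (v : M e) (hv : v ∈ S.1) : OFace α x y (m - 1) :=
  ⟨S.1.erase v,
    ⟨fun μ hμ => S.2.1.1 μ (Finset.mem_of_mem_erase hμ),
      S.2.1.2.mono (Finset.coe_subset.mpr (Finset.erase_subset _ _))⟩,
    by rw [Finset.card_erase_of_mem hv, S.2.2]⟩

/-- The simplicial boundary map of the (augmented) chain complex of `Δ(x,y)`;
the sign of the deletion of a vertex `v` is `(-1)^(number of vertices below v)`. -/
def obd (K : Type) [Field K] (α : Fin n → M e) (x y : M e) (m : ℕ) :
    OC K α x y m →ₗ[K] OC K α x y (m - 1) :=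
  Finsupp.linearCombination K fun S : OFace α x y m =>
    ∑ v ∈ S.1.attach,
      ((-1 : K) ^ (S.1.filter fun w => sgLT α w v.1).card) •
        Finsupp.single (erasedOFace S v.1 v.2) 1

/-- Vanishing of the reduced simplicial homology `H̃_i(Δ(x,y); K)`, for `i : ℤ`:
every reduced `i`-cycle is a boundary.  (An `i`-dimensional face has `i + 1`
vertices; for `i ≤ -2` the statement is vacuous, as is the reduced homology.) -/
def HredVanishes (K : Type) [Field K] (α : Fin n → M e) (x y : M e) (i : ℤ) : Prop :=
  ∀ m : ℕ, (m : ℤ) = i + 1 →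
    ∀ c : OC K α x y m, obd K α x y m c = 0 →
      ∃ b : OC K α x y (m + 1), obd K α x y (m + 1) b = c

/-- The reduced simplicial homology group `H̃_(m-1)(Δ(x,y); K)` :
cycles in the chain group spanned by faces with `m` vertices modulo boundaries,
realized as the image of the cycles in the cokernel of the boundary map. -/
abbrev HredMod (K : Type) [Field K] (α : Fin n → M e) (x y : M e) (m : ℕ) : Type :=
  ↥(Submodule.map (Submodule.mkQ (LinearMap.range (obd K α x y (m + 1))))
      (LinearMap.ker (obd K α x y m)))

end ASG
namespace ASG

variable {e n : ℕ}

/-- The toric ideal `I_Λ = ker φ ⊆ k[z_1, …, z_n]`, where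
`φ(z_i) = x^(α i) ∈ k[Λ] ⊆ k[x_1, …, x_e]`. -/
def toricIdeal (k : Type) [Field k] (α : Fin n → M e) : Ideal (MvPolynomial (Fin n) k) :=
  RingHom.ker (MvPolynomial.aeval (R := k)
    fun i : Fin n => (MvPolynomial.monomial (α i) 1 : MvPolynomial (Fin e) k))

/-- A monomial term order on `k[z_1, …, z_n]` (monomials identified with their
exponent vectors in `ℕ^n`): a linear order such that `1` is least and which is
compatible with multiplication of monomials. -/
def IsTermOrder (ord : LinearOrder (Fin n →₀ ℕ)) : Prop :=
  (∀ a, ord.le 0 a) ∧ ∀ a b c, ord.le a b → ord.le (a + c) (b + c)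

/-- The initial ideal `in_⪯(I_Λ)`: the ideal generated by the `⪯`-leading
monomials of the nonzero elements of `I_Λ`. -/
def initialIdeal (k : Type) [Field k] (ord : LinearOrder (Fin n →₀ ℕ)) (α : Fin n → M e) :
    Ideal (MvPolynomial (Fin n) k) :=
  Ideal.span {p | ∃ f ∈ toricIdeal k α, f ≠ 0 ∧ ∃ mo : Fin n →₀ ℕ,
    (mo ∈ f.support ∧ ∀ m' ∈ f.support, ord.le m' mo) ∧ p = MvPolynomial.monomial mo 1}

/-- `I_Λ` has a Gröbner basis of degree `d` with respect to `⪯` iff `in_⪯(I_Λ)`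
is generated by monomials of total degree at most `d`. -/
def HasGB (k : Type) [Field k] (ord : LinearOrder (Fin n →₀ ℕ)) (α : Fin n → M e)
    (d : ℕ) : Prop :=
  ∃ G : Set (Fin n →₀ ℕ), (∀ mo ∈ G, (mo.sum fun _ c => c) ≤ d) ∧
    Ideal.span ((fun mo => (MvPolynomial.monomial mo 1 : MvPolynomial (Fin n) k)) '' G)
      = initialIdeal k ord α

end ASG
namespace ASG

variable {e n : ℕ}

/-- The geometric realization of the order complex `Δ(x,y)`: convex
combinations of the vertices, supported on a face (with the topology inherited
from the product topology; since `Δ(x,y)` is a finite complex this is the weak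
topology). -/
abbrev Geom (α : Fin n → M e) (x y : M e) : Type :=
  { f : M e → ℝ // (∀ μ, 0 ≤ f μ) ∧
      ∃ S : Finset (M e), IsOFace α x y S ∧ S.Nonempty ∧
        (∀ μ, f μ ≠ 0 → μ ∈ S) ∧ ∑ μ ∈ S, f μ = 1 }

/-- The base point of the `D`-dimensional unit sphere. -/
def spherePt (D : ℕ) : Metric.sphere (0 : EuclideanSpace ℝ (Fin (D + 1))) 1 :=
  ⟨EuclideanSpace.single 0 1, by
    simp [mem_sphere_iff_norm, EuclideanSpace.norm_single]⟩

/-- Base-point identification for building a wedge of spheres. -/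
def wedgeBase {ι : Type} {D : ℕ}
    (z : Unit ⊕ (Σ _ : ι, Metric.sphere (0 : EuclideanSpace ℝ (Fin (D + 1))) 1)) : Prop :=
  z = Sum.inl () ∨ ∃ i : ι, z = Sum.inr ⟨i, spherePt D⟩

/-- The wedge of an `ι`-indexed family of `D`-dimensional spheres: the disjoint
union of the spheres and an extra point, with all base points and the extra
point identified.  For `ι` empty this is a one-point space. -/
abbrev Wedge (ι : Type) (D : ℕ) : Type :=
  Quot fun a b : Unit ⊕ (Σ _ : ι, Metric.sphere (0 : EuclideanSpace ℝ (Fin (D + 1))) 1) =>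
    wedgeBase a ∧ wedgeBase b

/-- The dimension of the order complex `Δ(x,y)`: the largest `m` such that
there is a face with `m + 1` vertices. -/
def dimOC (α : Fin n → M e) (x y : M e) : ℕ :=
  sSup {m : ℕ | ∃ S : Finset (M e), IsOFace α x y S ∧ S.card = m + 1}

end ASG

namespace ASG
open Metric Set

/-- `A` is `(c-2)`-connected: maps from spheres of dimension `< c - 1` into `A` extend to balls. -/
def NC {V : Type} (c : ℕ) (A : Set (V → ℝ)) : Prop :=
  ∀ (ι : Type) [Fintype ι], Fintype.card ι < c → ∀ f : (ι → ℝ) → (V → ℝ),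
    ContinuousOn f (sphere 0 1) → MapsTo f (sphere 0 1) A →
    ∃ g : (ι → ℝ) → (V → ℝ), ContinuousOn g (closedBall 0 1) ∧
      MapsTo g (closedBall 0 1) A ∧ EqOn g f (sphere 0 1)

/-- Extend `f` over the ball when it is straight-line homotopic to an extendable map. -/
theorem extend_of_segment {V : Type} {ι : Type} [Fintype ι] {A : Set (V → ℝ)}
    {f g' : (ι → ℝ) → (V → ℝ)}
    (hf : ContinuousOn f (sphere 0 1)) (hg : ContinuousOn g' (closedBall 0 1))
    (hgA : MapsTo g' (closedBall 0 1) A)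
    (hseg : ∀ y ∈ sphere (0 : ι → ℝ) 1, ∀ t : ℝ, 0 ≤ t → t ≤ 1 → t • f y + (1 - t) • g' y ∈ A) :
    ∃ g : (ι → ℝ) → (V → ℝ), ContinuousOn g (closedBall 0 1) ∧
      MapsTo g (closedBall 0 1) A ∧ EqOn g f (sphere 0 1) := by
  set h : (ι → ℝ) → (V → ℝ) := fun y =>
    (2 * ‖y‖ - 1) • f (‖y‖⁻¹ • y) + (1 - (2 * ‖y‖ - 1)) • g' (‖y‖⁻¹ • y) with hh
  set g : (ι → ℝ) → (V → ℝ) := fun y => if ‖y‖ ≤ 1 / 2 then g' ((2 : ℝ) • y) else h y with hgdef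
  have hunit : ∀ y : ι → ℝ, 1 / 2 ≤ ‖y‖ → ‖y‖⁻¹ • y ∈ sphere (0 : ι → ℝ) 1 := by
    intro y hy
    have : ‖y‖ ≠ 0 := by linarith
    simp [norm_smul, this]
  have e1 : EqOn g (fun y => g' ((2 : ℝ) • y)) {y | ‖y‖ ≤ 1 / 2} := by
    intro y hy
    have hy' : ‖y‖ ≤ 1 / 2 := hy
    simp only [hgdef, if_pos hy']
  have e2 : EqOn g h {y | 1 / 2 ≤ ‖y‖ ∧ ‖y‖ ≤ 1} := by
    rintro y ⟨hy, -⟩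
    by_cases hy' : ‖y‖ ≤ 1 / 2
    · have h2 : ‖y‖ = 1 / 2 := le_antisymm hy' hy
      simp only [hgdef, if_pos hy', hh, h2]
      norm_num
    · simp only [hgdef, if_neg hy']
  have c1 : ContinuousOn g {y | ‖y‖ ≤ 1 / 2} := by
    refine ContinuousOn.congr ?_ e1
    refine hg.comp (continuous_const_smul (2 : ℝ)).continuousOn ?_
    intro y hy
    have hy' : ‖y‖ ≤ 1 / 2 := hy
    simp only [mem_closedBall, dist_zero_right, norm_smul]
    norm_num; linarith
  have c2 : ContinuousOn g {y | 1 / 2 ≤ ‖y‖ ∧ ‖y‖ ≤ 1} := by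
    refine ContinuousOn.congr ?_ e2
    have cu : ContinuousOn (fun y : ι → ℝ => ‖y‖⁻¹ • y) {y | 1 / 2 ≤ ‖y‖ ∧ ‖y‖ ≤ 1} := by
      refine ContinuousOn.smul (ContinuousOn.inv₀ continuous_norm.continuousOn ?_) continuousOn_id
      rintro y ⟨hy, -⟩
      linarith
    have hm : MapsTo (fun y : ι → ℝ => ‖y‖⁻¹ • y) {y | 1 / 2 ≤ ‖y‖ ∧ ‖y‖ ≤ 1} (sphere 0 1) :=
      fun y hy => hunit y hy.1
    have k1 : ContinuousOn (fun y : ι → ℝ => 2 * ‖y‖ - 1) {y | 1 / 2 ≤ ‖y‖ ∧ ‖y‖ ≤ 1} := by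
      fun_prop
    have k2 : ContinuousOn (fun y : ι → ℝ => 1 - (2 * ‖y‖ - 1)) {y | 1 / 2 ≤ ‖y‖ ∧ ‖y‖ ≤ 1} := by
      fun_prop
    exact ContinuousOn.add (ContinuousOn.smul k1 (hf.comp cu hm))
      (ContinuousOn.smul k2 ((hg.mono sphere_subset_closedBall).comp cu hm))
  refine ⟨g, ?_, ?_, ?_⟩
  · have := c1.union_of_isClosed c2 (isClosed_le continuous_norm continuous_const)
      ((isClosed_le continuous_const continuous_norm).inter
        (isClosed_le continuous_norm continuous_const))
    refine this.mono ?_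
    intro y hy
    have : ‖y‖ ≤ 1 := by simpa using hy
    rcases le_total ‖y‖ (1 / 2) with h | h
    · exact Or.inl h
    · exact Or.inr ⟨h, this⟩
  · intro y hy
    have hy1 : ‖y‖ ≤ 1 := by simpa using hy
    rcases le_total ‖y‖ (1 / 2) with h | h
    · rw [e1 h]
      apply hgA
      simp only [mem_closedBall, dist_zero_right, norm_smul]
      norm_num; linarith
    · rw [e2 ⟨h, hy1⟩]
      exact hseg _ (hunit y h) _ (by linarith) (by linarith)
  · intro y hy
    have hy1 : ‖y‖ = 1 := by simpa using hy
    rw [e2 ⟨by rw [hy1]; norm_num, hy1.le⟩]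
    simp only [hh, hy1]
    norm_num

theorem NC.mono {V : Type} {c c' : ℕ} {A : Set (V → ℝ)} (h : NC c A) (hc : c' ≤ c) : NC c' A :=
  fun ι _ hι => h ι (lt_of_lt_of_le hι hc)

/-- Homotopy domination by straight-line homotopies. -/
theorem NC.dom {V : Type} {c : ℕ} {A A' : Set (V → ℝ)} (h : NC c A')
    (φ ψ : (V → ℝ) → (V → ℝ)) (hφ : ContinuousOn φ A) (hψ : ContinuousOn ψ A')
    (hφA : MapsTo φ A A') (hψA : MapsTo ψ A' A)
    (hseg : ∀ x ∈ A, ∀ t : ℝ, 0 ≤ t → t ≤ 1 → t • x + (1 - t) • ψ (φ x) ∈ A) : NC c A := by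
  intro ι _ hι f hf hfA
  obtain ⟨g, hg, hgA, hgf⟩ := h ι hι (φ ∘ f) (hφ.comp hf hfA) (hφA.comp hfA)
  refine extend_of_segment (g' := ψ ∘ g) hf (hψ.comp hg hgA) (hψA.comp hgA) ?_
  intro y hy t h0 h1
  have : (ψ ∘ g) y = ψ (φ (f y)) := by simp [hgf hy]
  rw [this]
  exact hseg _ (hfA hy) t h0 h1

/-- Star-shaped sets are `NC c` for every `c`. -/
theorem NC.star {V : Type} {c : ℕ} {A : Set (V → ℝ)} (v : V → ℝ) (hv : v ∈ A)
    (hseg : ∀ x ∈ A, ∀ t : ℝ, 0 ≤ t → t ≤ 1 → t • x + (1 - t) • v ∈ A) : NC c A := by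
  intro ι _ hι f hf hfA
  exact extend_of_segment (g' := fun _ => v) hf continuousOn_const (fun _ _ => hv)
    (fun y hy t h0 h1 => hseg _ (hfA hy) t h0 h1)

/-- Unit lattice cube with corner `a` and directions `S`. -/
def cube {ι : Type} (a : ι → ℤ) (S : Finset ι) : Set (ι → ℝ) :=
  {x | ∀ i, (i ∈ S → (a i : ℝ) ≤ x i ∧ x i ≤ a i + 1) ∧ (i ∉ S → x i = a i)}

/-- The non-integral coordinates of a point. -/
def nonint {ι : Type} [Fintype ι] (x : ι → ℝ) : Finset ι :=
  Finset.univ.filter fun i => Int.fract (x i) ≠ 0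

theorem isClosed_cube {ι : Type} (a : ι → ℤ) (S : Finset ι) : IsClosed (cube a S) := by
  have : cube a S = ⋂ i, ({x : ι → ℝ | i ∈ S → (a i : ℝ) ≤ x i ∧ x i ≤ a i + 1} ∩
      {x | i ∉ S → x i = a i}) := by
    ext x; simp [cube]
  rw [this]
  refine isClosed_iInter fun i => ?_
  by_cases h : i ∈ S
  · simp only [h, forall_const, not_true_eq_false, IsEmpty.forall_iff, ofPred_true, inter_univ]
    exact (isClosed_le continuous_const (continuous_apply i)).inter
      (isClosed_le (continuous_apply i) continuous_const)
  · simp only [h, IsEmpty.forall_iff, ofPred_true, not_false_eq_true, forall_const, univ_inter]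
    exact isClosed_eq (continuous_apply i) continuous_const

theorem nonint_subset {ι : Type} [Fintype ι] {a : ι → ℤ} {S : Finset ι} {x : ι → ℝ}
    (hx : x ∈ cube a S) : nonint x ⊆ S := by
  intro i hi
  by_contra h
  have := (hx i).2 h
  simp [nonint, this] at hi

theorem mem_cube_self {ι : Type} [Fintype ι] (x : ι → ℝ) :
    x ∈ cube (fun i => ⌊x i⌋) (nonint x) := by
  intro i
  refine ⟨fun _ => ⟨Int.floor_le _, (Int.lt_floor_add_one _).le⟩, fun h => ?_⟩
  simp only [nonint, ne_eq, Finset.mem_filter, Finset.mem_univ, true_and, not_not] at h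
  have := Int.floor_add_fract (x i)
  rw [h] at this; linarith

/-- In a cube with `nonint x = S`, the corner is the floor of `x`. -/
theorem floor_eq_of_cube {ι : Type} [Fintype ι] {a : ι → ℤ} {S : Finset ι} {x : ι → ℝ}
    (hx : x ∈ cube a S) (h : nonint x = S) : (fun i => ⌊x i⌋) = a := by
  funext i
  by_cases hi : i ∈ S
  · have h1 := (hx i).1 hi
    rw [Int.floor_eq_iff]
    refine ⟨h1.1, lt_of_le_of_ne h1.2 ?_⟩
    intro h2
    rw [← h] at hi
    simp only [nonint, ne_eq, Finset.mem_filter, Finset.mem_univ, true_and] at hi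
    apply hi
    rw [h2]; simp
  · rw [(hx i).2 hi]; simp

/-- Relative boundary of a cube. -/
def cubeBd {ι : Type} (a : ι → ℤ) (S : Finset ι) : Set (ι → ℝ) :=
  {x | x ∈ cube a S ∧ ∃ i ∈ S, x i = a i ∨ x i = a i + 1}

/-- Facets of a cube. -/
def facetCorner {ι : Type} (a : ι → ℤ) (i : ι) (b : Bool) : ι → ℤ :=
  Function.update a i (a i + if b then 1 else 0)

theorem facet_subset {ι : Type} {a : ι → ℤ} {S : Finset ι} {i : ι} (hi : i ∈ S) (b : Bool) :
    cube (facetCorner a i b) (S.erase i) ⊆ cube a S := by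
  intro x hx l
  by_cases h : l = i
  · subst h
    have := (hx l).2 (by simp)
    simp only [facetCorner, Function.update_self] at this
    refine ⟨fun _ => ?_, fun h => absurd hi h⟩
    rw [this]; cases b <;> simp
  · have := hx l
    simp only [facetCorner, Function.update_of_ne h, Finset.mem_erase, ne_eq, h,
      not_false_eq_true, true_and] at this
    exact this

theorem cubeBd_eq {ι : Type} (a : ι → ℤ) (S : Finset ι) :
    cubeBd a S = ⋃ p : S × Bool, cube (facetCorner a p.1 p.2) (S.erase p.1) := by
  ext x
  simp only [mem_iUnion, Prod.exists]
  constructor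
  · rintro ⟨hx, i, hi, h⟩
    rcases h with h | h
    · refine ⟨⟨i, hi⟩, false, fun l => ?_⟩
      by_cases hl : l = i
      · subst hl; simp [facetCorner, h]
      · have := hx l
        simpa [facetCorner, Function.update_of_ne hl, hl] using this
    · refine ⟨⟨i, hi⟩, true, fun l => ?_⟩
      by_cases hl : l = i
      · subst hl; simp [facetCorner, h]
      · have := hx l
        simpa [facetCorner, Function.update_of_ne hl, hl] using this
  · rintro ⟨⟨i, hi⟩, b, hx⟩
    refine ⟨facet_subset hi b hx, i, hi, ?_⟩
    have := (hx i).2 (by simp)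
    simp only [facetCorner, Function.update_self] at this
    cases b
    · left; simpa using this
    · right; simpa using this

theorem mem_cubeBd_of_nonint {ι : Type} [Fintype ι] {a : ι → ℤ} {S : Finset ι} {x : ι → ℝ}
    (hx : x ∈ cube a S) (h : nonint x ≠ S) : x ∈ cubeBd a S := by
  have hss : nonint x ⊂ S := lt_of_le_of_ne (nonint_subset hx) h
  obtain ⟨i, hi, hin⟩ := Finset.exists_of_ssubset hss
  refine ⟨hx, i, hi, ?_⟩
  simp only [nonint, ne_eq, Finset.mem_filter, Finset.mem_univ, true_and, not_not] at hin
  rw [Int.fract_eq_iff] at hin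
  obtain ⟨-, -, z, hz⟩ := hin
  rw [sub_zero] at hz
  have h1 := (hx i).1 hi
  rw [hz] at h1 ⊢
  have h2 : a i ≤ z ∧ z ≤ a i + 1 := by exact_mod_cast h1
  have : z = a i ∨ z = a i + 1 := by omega
  rcases this with h | h
  · left; rw [h]
  · right; rw [h]; push_cast; rfl

/-- Filling a cube inside a sufficiently connected set. -/
theorem fill_cube {V : Type} {c : ℕ} {Y : Set (V → ℝ)} (hY : NC c Y) {ι : Type}
    (a : ι → ℤ) (S : Finset ι) (hS : S.card < c) (g : (ι → ℝ) → (V → ℝ))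
    (hg : ContinuousOn g (cubeBd a S)) (hgY : MapsTo g (cubeBd a S) Y) :
    ∃ G : (ι → ℝ) → (V → ℝ), ContinuousOn G (cube a S) ∧ MapsTo G (cube a S) Y ∧
      EqOn G g (cubeBd a S) := by
  set p : (ι → ℝ) → (S → ℝ) := fun x i => 2 * (x i - a i) - 1 with hp
  set q : (S → ℝ) → (ι → ℝ) := fun y i => if h : i ∈ S then a i + (y ⟨i, h⟩ + 1) / 2 else a i
    with hq
  have hpc : Continuous p := by rw [hp]; fun_prop
  have hqc : Continuous q := by
    refine continuous_pi fun i => ?_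
    by_cases h : i ∈ S
    · simp only [hq, h, dite_true]; fun_prop
    · simp only [hq, h, dite_false]; fun_prop
  have hqp : ∀ x ∈ cube a S, q (p x) = x := by
    intro x hx
    funext i
    by_cases h : i ∈ S
    · simp only [hq, hp, h, dite_true]; ring
    · simp only [hq, h, dite_false]; exact ((hx i).2 h).symm
  have hpb : MapsTo p (cube a S) (closedBall 0 1) := by
    intro x hx
    rw [mem_closedBall, dist_zero_right, pi_norm_le_iff_of_nonneg zero_le_one]
    intro i
    have := (hx i).1 i.2
    rw [Real.norm_eq_abs, abs_le]
    constructor <;> simp only [hp] <;> linarith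
  have hps : MapsTo p (cubeBd a S) (sphere 0 1) := by
    rintro x ⟨hx, i, hi, h⟩
    have h1 := hpb hx
    rw [mem_closedBall, dist_zero_right] at h1
    rw [mem_sphere, dist_zero_right]
    refine le_antisymm h1 ?_
    refine le_trans ?_ (norm_le_pi_norm (p x) ⟨i, hi⟩)
    rw [Real.norm_eq_abs]
    rcases h with h | h <;> simp only [hp, h] <;> norm_num
  have hqs : MapsTo q (sphere 0 1) (cubeBd a S) := by
    intro y hy
    rw [mem_sphere, dist_zero_right] at hy
    have hle : ∀ i, |y i| ≤ 1 := fun i => by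
      rw [← hy, ← Real.norm_eq_abs]; exact norm_le_pi_norm y i
    refine ⟨fun i => ⟨fun h => ?_, fun h => by simp [hq, h]⟩, ?_⟩
    · have := abs_le.mp (hle ⟨i, h⟩)
      simp only [hq, h, dite_true]
      constructor <;> linarith
    · have : ∃ i, |y i| = 1 := by
        by_contra hcon
        push Not at hcon
        have : ‖y‖ < 1 := by
          rw [pi_norm_lt_iff zero_lt_one]
          exact fun i => lt_of_le_of_ne (hle i) (hcon i)
        linarith
      obtain ⟨⟨i, hi⟩, h⟩ := this
      refine ⟨i, hi, ?_⟩
      simp only [hq, hi, dite_true]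
      rcases (abs_eq zero_le_one).mp h with h | h
      · right; rw [h]; norm_num
      · left; rw [h]; norm_num
  obtain ⟨G, hG, hGY, hGg⟩ := hY S (by simpa using hS) (g ∘ q) (hg.comp hqc.continuousOn hqs)
    (hgY.comp hqs)
  refine ⟨G ∘ p, hG.comp hpc.continuousOn hpb, hGY.comp hpb, ?_⟩
  intro x hx
  simp only [Function.comp_apply]
  rw [hGg (hps hx), Function.comp_apply, hqp x hx.1]

end ASG

namespace ASG
open Metric Set

/-- Invariant for the cell-by-cell deformation into `A`. -/
def CubeInv {V ι : Type} (D : Set (ι → ℝ)) (F : (ι → ℝ) → (V → ℝ)) (A B : Set (V → ℝ))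
    (g : (ι → ℝ) → (V → ℝ)) (k : ℕ) : Prop :=
  ∀ (a : ι → ℤ) (S : Finset ι), S.card < k → cube a S ⊆ D →
    ContinuousOn g (cube a S) ∧ MapsTo g (cube a S) A ∧
    (MapsTo F (cube a S) B → MapsTo g (cube a S) B) ∧
    (MapsTo F (cube a S) A → EqOn g F (cube a S))

theorem cubeInv_step {V ι : Type} [Fintype ι] {D : Set (ι → ℝ)} {F : (ι → ℝ) → (V → ℝ)}
    {A B : Set (V → ℝ)} {g : (ι → ℝ) → (V → ℝ)} {k c : ℕ} (hF : ContinuousOn F D)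
    (hcov : ∀ (a : ι → ℤ) (S : Finset ι), cube a S ⊆ D →
      MapsTo F (cube a S) A ∨ MapsTo F (cube a S) B)
    (hAB : NC c (A ∩ B)) (hk : k < c) (hg : CubeInv D F A B g k) :
    ∃ g', CubeInv D F A B g' (k + 1) := by
  have key : ∀ (a : ι → ℤ) (S : Finset ι), ∃ G : (ι → ℝ) → (V → ℝ), S.card = k → cube a S ⊆ D →
      ContinuousOn G (cube a S) ∧ MapsTo G (cube a S) A ∧
      (MapsTo F (cube a S) B → MapsTo G (cube a S) B) ∧
      (MapsTo F (cube a S) A → EqOn G F (cube a S)) ∧ EqOn G g (cubeBd a S) := by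
    intro a S
    by_cases hS : S.card = k ∧ cube a S ⊆ D
    swap
    · exact ⟨g, fun h1 h2 => absurd ⟨h1, h2⟩ hS⟩
    obtain ⟨hSk, hSD⟩ := hS
    have hfac : ∀ p : S × Bool, (S.erase p.1).card < k ∧
        cube (facetCorner a p.1 p.2) (S.erase p.1) ⊆ cube a S := by
      rintro ⟨⟨i, hi⟩, b⟩
      refine ⟨?_, facet_subset hi b⟩
      rw [← hSk]; exact Finset.card_erase_lt_of_mem hi
    by_cases hFA : MapsTo F (cube a S) A
    · refine ⟨F, fun _ _ => ⟨hF.mono hSD, hFA, id, fun _ => eqOn_refl _ _, ?_⟩⟩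
      intro x hx
      rw [cubeBd_eq, mem_iUnion] at hx
      obtain ⟨p, hp⟩ := hx
      have := hg _ _ (hfac p).1 ((hfac p).2.trans hSD)
      exact (this.2.2.2 (hFA.mono_left (hfac p).2) hp).symm
    · have hFB := (hcov a S hSD).resolve_left hFA
      obtain ⟨G, hG, hGY, hGg⟩ := fill_cube hAB a S (by omega) g
        (by
          rw [cubeBd_eq]
          refine (locallyFinite_of_finite _).continuousOn_iUnion (fun p => isClosed_cube _ _) ?_
          intro p
          exact (hg _ _ (hfac p).1 ((hfac p).2.trans hSD)).1)
        (by
          intro x hx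
          rw [cubeBd_eq, mem_iUnion] at hx
          obtain ⟨p, hp⟩ := hx
          have := hg _ _ (hfac p).1 ((hfac p).2.trans hSD)
          exact ⟨this.2.1 hp, this.2.2.1 (hFB.mono_left (hfac p).2) hp⟩)
      exact ⟨G, fun _ _ => ⟨hG, fun x hx => (hGY hx).1, fun _ x hx => (hGY hx).2,
        fun h => absurd h hFA, hGg⟩⟩
  choose G hG using key
  set g' : (ι → ℝ) → (V → ℝ) := fun x =>
    if (nonint x).card < k then g x else G (fun i => ⌊x i⌋) (nonint x) x with hg'
  refine ⟨g', fun a S hS hSD => ?_⟩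
  rcases Nat.lt_succ_iff_lt_or_eq.mp hS with hlt | heq
  · have he : EqOn g' g (cube a S) := by
      intro x hx
      have : (nonint x).card < k := lt_of_le_of_lt (Finset.card_le_card (nonint_subset hx)) hlt
      simp only [hg', if_pos this]
    obtain ⟨h1, h2, h3, h4⟩ := hg a S hlt hSD
    exact ⟨h1.congr he, h2.congr he.symm, fun h => (h3 h).congr he.symm, fun h => he.trans (h4 h)⟩
  · obtain ⟨h1, h2, h3, h4, h5⟩ := hG a S heq hSD
    have he : EqOn g' (G a S) (cube a S) := by
      intro x hx
      by_cases h : nonint x = S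
      · have : ¬ (nonint x).card < k := by rw [h, heq]; simp
        simp only [hg', if_neg this]
        rw [floor_eq_of_cube hx h, h]
      · have hlt : (nonint x).card < k := by
          rw [← heq]
          exact Finset.card_lt_card (lt_of_le_of_ne (nonint_subset hx) h)
        simp only [hg', if_pos hlt]
        exact (h5 (mem_cubeBd_of_nonint hx h)).symm
    exact ⟨h1.congr he, h2.congr he.symm, fun h => (h3 h).congr he.symm, fun h => he.trans (h4 h)⟩

theorem exists_cubeInv {V ι : Type} [Fintype ι] {D : Set (ι → ℝ)} {F : (ι → ℝ) → (V → ℝ)}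
    {A B : Set (V → ℝ)} {c : ℕ} (hF : ContinuousOn F D)
    (hcov : ∀ (a : ι → ℤ) (S : Finset ι), cube a S ⊆ D →
      MapsTo F (cube a S) A ∨ MapsTo F (cube a S) B)
    (hAB : NC c (A ∩ B)) (k : ℕ) (hk : k ≤ c) : ∃ g, CubeInv D F A B g k := by
  induction k with
  | zero => exact ⟨F, fun a S h => absurd h (by simp)⟩
  | succ k ih =>
    obtain ⟨g, hg⟩ := ih (by omega)
    exact cubeInv_step hF hcov hAB (by omega) hg

theorem sphere_cover {ι : Type} [Fintype ι] {N : ℕ} (hN : 0 < N) {x : ι → ℝ}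
    (hx : x ∈ sphere (0 : ι → ℝ) N) : (nonint x).card < Fintype.card ι ∧
      cube (fun i => ⌊x i⌋) (nonint x) ⊆ sphere (0 : ι → ℝ) N := by
  rw [mem_sphere, dist_zero_right] at hx
  have hle : ∀ i, |x i| ≤ N := fun i => by
    rw [← hx, ← Real.norm_eq_abs]; exact norm_le_pi_norm x i
  have hNpos : (0 : ℝ) < N := by exact_mod_cast hN
  obtain ⟨i, hi⟩ : ∃ i, |x i| = N := by
    by_contra hcon
    push Not at hcon
    have : ‖x‖ < N := by
      rw [pi_norm_lt_iff hNpos]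
      exact fun i => lt_of_le_of_ne (hle i) (hcon i)
    linarith
  have hz : ∃ z : ℤ, x i = z := by
    rcases (abs_eq hNpos.le).mp hi with h | h
    · exact ⟨N, by rw [h]; simp⟩
    · exact ⟨-N, by rw [h]; simp⟩
  have hin : i ∉ nonint x := by
    obtain ⟨z, hz⟩ := hz
    simp [nonint, hz]
  refine ⟨?_, ?_⟩
  · rw [← Finset.card_univ]
    refine Finset.card_lt_card ⟨Finset.subset_univ _, fun h => hin (h (Finset.mem_univ i))⟩
  · intro y hy
    have hyi : y i = x i := by
      rw [(hy i).2 hin, (mem_cube_self x i).2 hin]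
    rw [mem_sphere, dist_zero_right]
    refine le_antisymm ?_ ?_
    · rw [pi_norm_le_iff_of_nonneg hNpos.le]
      intro l
      rw [Real.norm_eq_abs, abs_le]
      have hxl := abs_le.mp (hle l)
      by_cases hl : l ∈ nonint x
      · have h1 := (hy l).1 hl
        have f1 : (-N : ℤ) ≤ ⌊x l⌋ := by rw [Int.le_floor]; push_cast; linarith
        have f1' : (-N : ℝ) ≤ ⌊x l⌋ := by exact_mod_cast f1
        have f2 : ⌊x l⌋ < (N : ℤ) := by
          rw [Int.floor_lt]; push_cast
          refine lt_of_le_of_ne hxl.2 ?_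
          intro h
          simp [nonint, h] at hl
        have f2' : (⌊x l⌋ : ℝ) + 1 ≤ N := by exact_mod_cast f2
        constructor <;> linarith
      · have := (hy l).2 hl
        rw [this, ← (mem_cube_self x l).2 hl]
        exact hxl
    · rw [← hi, ← hyi, ← Real.norm_eq_abs]
      exact norm_le_pi_norm y i

theorem cube_dist {ι : Type} [Fintype ι] {a : ι → ℤ} {S : Finset ι} {x y : ι → ℝ}
    (hx : x ∈ cube a S) (hy : y ∈ cube a S) : ‖y - x‖ ≤ 1 := by
  rw [pi_norm_le_iff_of_nonneg zero_le_one]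
  intro i
  rw [Real.norm_eq_abs, abs_le, Pi.sub_apply]
  by_cases h : i ∈ S
  · have h1 := (hx i).1 h
    have h2 := (hy i).1 h
    constructor <;> linarith
  · rw [(hx i).2 h, (hy i).2 h]; simp

/-- Gluing lemma: `X = (X ∩ U) ∪ (X ∩ W)` with `X ∩ W` convex. -/
theorem NC.glue {V : Type} {c : ℕ} {X U W : Set (V → ℝ)} (hU : IsOpen U) (hW : IsOpen W)
    (hX : X ⊆ U ∪ W) (hconv : Convex ℝ (X ∩ W)) (hA : NC c (X ∩ U))
    (hAB : NC (c - 1) ((X ∩ U) ∩ (X ∩ W))) : NC c X := by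
  intro ι _ hι f hf hfX
  obtain ⟨U', hU', hUe⟩ := continuousOn_iff'.mp hf U hU
  obtain ⟨W', hW', hWe⟩ := continuousOn_iff'.mp hf W hW
  obtain ⟨δ, hδ, hleb⟩ := lebesgue_number_lemma_of_metric (s := sphere (0 : ι → ℝ) 1)
    (c := fun b : Bool => if b then U' else W') (isCompact_sphere _ _)
    (by intro b; cases b <;> simp [hU', hW'])
    (by
      intro x hx
      rw [mem_iUnion]
      rcases hX (hfX hx) with h | h
      · exact ⟨true, by have : x ∈ f ⁻¹' U ∩ sphere 0 1 := ⟨h, hx⟩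
                        rw [hUe] at this; simpa using this.1⟩
      · exact ⟨false, by have : x ∈ f ⁻¹' W ∩ sphere 0 1 := ⟨h, hx⟩
                         rw [hWe] at this; simpa using this.1⟩)
  obtain ⟨N, hN⟩ := exists_nat_gt (1 / δ)
  have hNpos' : (0 : ℝ) < N := lt_trans (by positivity) hN
  have hNpos : 0 < N := by exact_mod_cast hNpos'
  have hNδ : (N : ℝ)⁻¹ < δ := by
    rw [inv_lt_comm₀ hNpos' hδ]; simpa using hN
  set F : (ι → ℝ) → (V → ℝ) := fun x => f ((N : ℝ)⁻¹ • x) with hFdef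
  set D := sphere (0 : ι → ℝ) N with hD
  have hsc : MapsTo (fun x : ι → ℝ => (N : ℝ)⁻¹ • x) D (sphere 0 1) := by
    intro x hx
    have : ‖x‖ = N := by simpa [hD] using hx
    rw [mem_sphere, dist_zero_right, norm_smul, this]
    simp [hNpos'.ne']
  have hsc' : MapsTo (fun x : ι → ℝ => (N : ℝ) • x) (sphere 0 1) D := by
    intro x hx
    have : ‖x‖ = 1 := by simpa using hx
    rw [hD, mem_sphere, dist_zero_right, norm_smul, this]
    simp
  have hF : ContinuousOn F D := hf.comp (continuous_const_smul _).continuousOn hsc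
  have hFX : MapsTo F D X := hfX.comp hsc
  have hcov : ∀ (a : ι → ℤ) (S : Finset ι), cube a S ⊆ D →
      MapsTo F (cube a S) (X ∩ U) ∨ MapsTo F (cube a S) (X ∩ W) := by
    intro a S hS
    have hcorner : (fun i => (a i : ℝ)) ∈ cube a S := by intro i; simp
    obtain ⟨b, hb⟩ := hleb _ (hsc (hS hcorner))
    have hin : ∀ x ∈ cube a S, (N : ℝ)⁻¹ • x ∈ (if b then U' else W') := by
      intro x hx
      apply hb
      rw [mem_ball, dist_eq_norm]
      show ‖(N : ℝ)⁻¹ • x - (N : ℝ)⁻¹ • (fun i => (a i : ℝ))‖ < δ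
      rw [← smul_sub, norm_smul, norm_inv, Real.norm_natCast]
      have := cube_dist hcorner hx
      calc (N : ℝ)⁻¹ * ‖x - fun i => (a i : ℝ)‖ ≤ (N : ℝ)⁻¹ * 1 := by gcongr
        _ < δ := by simpa using hNδ
    cases b
    · right
      intro x hx
      refine ⟨hFX (hS hx), ?_⟩
      have h1 : (N : ℝ)⁻¹ • x ∈ W' ∩ sphere 0 1 := ⟨by simpa using hin x hx, hsc (hS hx)⟩
      rw [← hWe] at h1
      exact h1.1
    · left
      intro x hx
      refine ⟨hFX (hS hx), ?_⟩
      have h1 : (N : ℝ)⁻¹ • x ∈ U' ∩ sphere 0 1 := ⟨by simpa using hin x hx, hsc (hS hx)⟩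
      rw [← hUe] at h1
      exact h1.1
  obtain ⟨g, hg⟩ := exists_cubeInv hF hcov hAB (Fintype.card ι) (by omega)
  have hgD : ∀ x ∈ D, ∃ (a : ι → ℤ) (S : Finset ι), x ∈ cube a S ∧ cube a S ⊆ D ∧
      S.card < Fintype.card ι := fun x hx =>
    ⟨_, _, mem_cube_self x, (sphere_cover hNpos hx).2, (sphere_cover hNpos hx).1⟩
  have hgc : ContinuousOn g D := by
    have hfin : Set.Finite {p : (ι → ℤ) × Finset ι | (cube p.1 p.2 ⊆ D) ∧
        p.2.card < Fintype.card ι} := by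
      refine Set.Finite.subset (s := (Set.univ.pi fun _ : ι => Set.Icc (-N : ℤ) N) ×ˢ
        (Set.univ : Set (Finset ι))) ?_ ?_
      · exact (Set.Finite.pi fun _ => Set.finite_Icc _ _).prod Set.finite_univ
      · rintro ⟨a, S⟩ ⟨hp, -⟩
        have hcorner : (fun i => (a i : ℝ)) ∈ cube a S := by intro i; simp
        have h1 := hp hcorner
        rw [hD, mem_sphere, dist_zero_right] at h1
        refine ⟨fun i _ => ?_, Set.mem_univ _⟩
        have h2 := norm_le_pi_norm (fun i => (a i : ℝ)) i
        rw [h1, Real.norm_eq_abs, abs_le] at h2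
        constructor
        · exact_mod_cast h2.1
        · exact_mod_cast h2.2
    have := hfin.to_subtype
    have hcont : ContinuousOn g (⋃ p : {p : (ι → ℤ) × Finset ι | (cube p.1 p.2 ⊆ D) ∧
        p.2.card < Fintype.card ι}, cube p.1.1 p.1.2) :=
      (locallyFinite_of_finite _).continuousOn_iUnion (fun p => isClosed_cube _ _)
        (fun p => (hg _ _ p.2.2 p.2.1).1)
    refine hcont.mono ?_
    intro x hx
    obtain ⟨a, S, h1, h2, h3⟩ := hgD x hx
    exact mem_iUnion.mpr ⟨⟨(a, S), h2, h3⟩, h1⟩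
  have hgA : MapsTo g D (X ∩ U) := by
    intro x hx
    obtain ⟨a, S, h1, h2, h3⟩ := hgD x hx
    exact (hg a S h3 h2).2.1 h1
  obtain ⟨e, he, heA, hee⟩ := hA ι hι (fun y => g ((N : ℝ) • y))
    (hgc.comp (continuous_const_smul _).continuousOn hsc') (hgA.comp hsc')
  refine extend_of_segment (g' := e) hf he (fun y hy => (heA hy).1) ?_
  intro y hy t h0 h1
  rw [hee hy]
  have hyD := hsc' hy
  have hFy : F ((N : ℝ) • y) = f y := by
    simp only [hFdef, smul_smul, inv_mul_cancel₀ hNpos'.ne', one_smul]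
  obtain ⟨a, S, k1, k2, k3⟩ := hgD _ hyD
  obtain ⟨-, -, l3, l4⟩ := hg a S k3 k2
  simp only at k1 ⊢
  rcases hcov a S k2 with h | h
  · have : g ((N : ℝ) • y) = f y := by rw [l4 h k1, hFy]
    rw [this, ← add_smul]
    simpa using hfX hy
  · have a1 := h k1
    rw [hFy] at a1
    exact (hconv a1 (l3 h k1) h0 (by linarith) (by ring)).1

end ASG

namespace ASG
open Metric Set

/-- Closed simplex on the vertex set `S`. -/
def sx {V : Type} (S : Finset V) : Set (V → ℝ) :=
  {f | (∀ μ, 0 ≤ f μ) ∧ (∀ μ, f μ ≠ 0 → μ ∈ S) ∧ ∑ μ ∈ S, f μ = 1}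

/-- Geometric realization of a family of finite sets. -/
def Rl {V : Type} (K : Set (Finset V)) : Set (V → ℝ) := {f | ∃ S ∈ K, f ∈ sx S}

theorem sx_mono {V : Type} {S T : Finset V} (h : S ⊆ T) : sx S ⊆ sx T := by
  rintro f ⟨h0, h1, h2⟩
  refine ⟨h0, fun μ hμ => h (h1 μ hμ), ?_⟩
  rw [← h2]
  symm
  refine Finset.sum_subset h fun μ _ hμ => ?_
  by_contra hne
  exact hμ (h1 μ hne)

theorem sx_erase {V : Type} {S : Finset V} {f : V → ℝ} (hf : f ∈ sx S) {w : V} (hw : f w = 0) :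
    f ∈ sx (S.erase w) := by
  obtain ⟨h0, h1, h2⟩ := hf
  refine ⟨h0, fun μ hμ => Finset.mem_erase.mpr ⟨?_, h1 μ hμ⟩, ?_⟩
  · rintro rfl; exact hμ hw
  · rw [← h2]; exact Finset.sum_erase _ hw

theorem sx_convex {V : Type} (S : Finset V) : Convex ℝ (sx S) := by
  rintro f ⟨f0, f1, f2⟩ g ⟨g0, g1, g2⟩ a b ha hb hab
  refine ⟨fun μ => ?_, fun μ hμ => ?_, ?_⟩
  · have := mul_nonneg ha (f0 μ)
    have := mul_nonneg hb (g0 μ)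
    simp only [Pi.add_apply, Pi.smul_apply, smul_eq_mul]; linarith
  · by_contra h
    have e1 : f μ = 0 := by by_contra h'; exact h (f1 μ h')
    have e2 : g μ = 0 := by by_contra h'; exact h (g1 μ h')
    simp [e1, e2] at hμ
  · simp only [Pi.add_apply, Pi.smul_apply, smul_eq_mul, Finset.sum_add_distrib,
      ← Finset.mul_sum, f2, g2]
    linarith

theorem sx_seg {V : Type} {S : Finset V} {f g : V → ℝ} (hf : f ∈ sx S) (hg : g ∈ sx S) {t : ℝ}
    (h0 : 0 ≤ t) (h1 : t ≤ 1) : t • f + (1 - t) • g ∈ sx S :=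
  sx_convex S hf hg h0 (by linarith) (by ring)

theorem seg_self {V : Type} (f : V → ℝ) (t : ℝ) : t • f + (1 - t) • f = f := by
  rw [← add_smul]; simp

theorem single_mem_sx {V : Type} {S : Finset V} {v : V} (hv : v ∈ S) :
    (Pi.single v 1 : V → ℝ) ∈ sx S := by
  refine ⟨fun μ => ?_, fun μ hμ => ?_, ?_⟩
  · by_cases h : μ = v
    · subst h; simp
    · simp [h]
  · by_contra h
    have : μ ≠ v := by rintro rfl; exact h hv
    simp [this] at hμ
  · rw [Finset.sum_eq_single_of_mem v hv fun μ _ h => by simp [h]]; simp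

/-- Minimal coordinate over `τ`. -/
def mn {V : Type} (τ : Finset V) (hτ : τ.Nonempty) (x : V → ℝ) : ℝ := τ.inf' hτ x

theorem continuous_mn {V : Type} (τ : Finset V) (hτ : τ.Nonempty) : Continuous (mn τ hτ) := by
  unfold mn
  exact Continuous.finset_inf'_apply hτ fun i _ => continuous_apply i

theorem mn_le {V : Type} {τ : Finset V} (hτ : τ.Nonempty) (x : V → ℝ) {w : V} (hw : w ∈ τ) :
    mn τ hτ x ≤ x w := Finset.inf'_le _ hw

theorem exists_mn {V : Type} {τ : Finset V} (hτ : τ.Nonempty) (x : V → ℝ) :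
    ∃ w ∈ τ, x w = mn τ hτ x := by
  obtain ⟨w, hw, h⟩ := Finset.exists_mem_eq_inf' hτ x
  exact ⟨w, hw, h.symm⟩

theorem mn_nonneg {V : Type} {τ : Finset V} (hτ : τ.Nonempty) {x : V → ℝ} (hx : ∀ μ, 0 ≤ x μ) :
    0 ≤ mn τ hτ x := by
  obtain ⟨w, -, h⟩ := exists_mn hτ x
  rw [← h]; exact hx w

theorem mn_eq_zero {V : Type} {τ S : Finset V} (hτ : τ.Nonempty) {x : V → ℝ} (hx : x ∈ sx S)
    (h : ¬ τ ⊆ S) : mn τ hτ x = 0 := by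
  obtain ⟨w, hw, hwS⟩ := Finset.not_subset.mp h
  have : x w = 0 := by by_contra h'; exact hwS (hx.2.1 w h')
  exact le_antisymm (this ▸ mn_le hτ x hw) (mn_nonneg hτ hx.1)

/-- Elementary collapses preserve connectivity. -/
theorem NC.collapse {V : Type} {c : ℕ} {K : Set (Finset V)} {σ : Finset V} {v : V}
    (hσ : σ.Nonempty) (hv : v ∉ σ) (hK : ∀ S ∈ K, ¬ σ ⊆ S)
    (hfac : ∀ w ∈ σ, (insert v σ).erase w ∈ K) (h : NC c (Rl K)) :
    NC c (Rl (insert σ (insert (insert v σ) K))) := by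
  set τ := insert v σ with hτ
  set r : (V → ℝ) → (V → ℝ) := fun x μ =>
    x μ - (if μ ∈ σ then mn σ hσ x else 0) + (if μ = v then σ.card * mn σ hσ x else 0) with hr
  have hrc : Continuous r := by
    refine continuous_pi fun μ => ?_
    have := continuous_mn σ hσ
    simp only [hr]
    refine ((continuous_apply μ).sub ?_).add ?_
    · by_cases h1 : μ ∈ σ <;> simp only [h1, if_true, if_false] <;> fun_prop
    · by_cases h2 : μ = v <;> simp only [h2, if_true, if_false] <;> fun_prop
  have hmono : Rl K ⊆ Rl (insert σ (insert τ K)) := by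
    rintro x ⟨S, hS, hx⟩
    exact ⟨S, Or.inr (Or.inr hS), hx⟩
  have hid : ∀ S ∈ K, ∀ x ∈ sx S, r x = x := by
    intro S hS x hx
    have := mn_eq_zero hσ hx (hK S hS)
    funext μ
    simp [hr, this]
  have hτr : ∀ x ∈ sx τ, r x ∈ sx τ ∧ ∃ w ∈ σ, r x w = 0 := by
    intro x hx
    have hm := mn_nonneg hσ hx.1
    refine ⟨⟨fun μ => ?_, fun μ hμ => ?_, ?_⟩, ?_⟩
    · have h0 := hx.1 μ
      by_cases h1 : μ ∈ σ
      · have h2 : μ ≠ v := by rintro rfl; exact hv h1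
        have := mn_le hσ x h1
        simp only [hr, h1, h2, if_true, if_false]; linarith
      · have : (0 : ℝ) ≤ σ.card * mn σ hσ x := by positivity
        by_cases h2 : μ = v <;> simp only [hr, h1, h2, if_true, if_false]
        · rw [if_neg hv]; subst h2; linarith
        · linarith
    · by_contra hn
      have h1 : μ ∉ σ := fun h => hn (Finset.mem_insert_of_mem h)
      have h2 : μ ≠ v := by rintro rfl; exact hn (Finset.mem_insert_self _ _)
      have h3 : x μ = 0 := by by_contra h'; exact hn (hx.2.1 μ h')
      simp [hr, h1, h2, h3] at hμ
    · have hs := hx.2.2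
      have h1 : ∑ μ ∈ τ, (if μ ∈ σ then mn σ hσ x else 0) = σ.card * mn σ hσ x := by
        rw [hτ, Finset.sum_insert hv, if_neg hv, zero_add,
          Finset.sum_congr rfl (g := fun _ => mn σ hσ x) (fun μ hμ => by rw [if_pos hμ])]
        simp
      have h2 : ∑ μ ∈ τ, (if μ = v then σ.card * mn σ hσ x else 0) = σ.card * mn σ hσ x := by
        rw [Finset.sum_ite_eq' τ v]; simp [hτ]
      simp only [hr]
      rw [Finset.sum_add_distrib, Finset.sum_sub_distrib, h1, h2, hs]; ring
    · obtain ⟨w, hw, hwm⟩ := exists_mn hσ x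
      refine ⟨w, hw, ?_⟩
      have h2 : w ≠ v := by rintro rfl; exact hv hw
      simp [hr, hw, h2, hwm]
  have hcases : ∀ x ∈ Rl (insert σ (insert τ K)), (∃ S ∈ K, x ∈ sx S) ∨ x ∈ sx τ := by
    rintro x ⟨S, hS, hx⟩
    rcases hS with rfl | rfl | hS
    · exact Or.inr (sx_mono (Finset.subset_insert _ _) hx)
    · exact Or.inr hx
    · exact Or.inl ⟨S, hS, hx⟩
  refine h.dom r id hrc.continuousOn continuousOn_id ?_ hmono ?_
  · intro x hx
    rcases hcases x hx with ⟨S, hS, hxS⟩ | hxτ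
    · rw [hid S hS x hxS]; exact ⟨S, hS, hxS⟩
    · obtain ⟨h1, w, hw, h2⟩ := hτr x hxτ
      exact ⟨_, hfac w hw, sx_erase h1 h2⟩
  · intro x hx t h0 h1
    rcases hcases x hx with ⟨S, hS, hxS⟩ | hxτ
    · rw [id, hid S hS x hxS, seg_self]; exact hx
    · exact ⟨τ, Or.inr (Or.inl rfl), sx_seg hxτ (hτr x hxτ).1 h0 h1⟩

/-- Attaching a simplex along its whole boundary. -/
theorem NC.attach {V : Type} {c : ℕ} {K : Set (Finset V)} {τ : Finset V}
    (hτ : τ.Nonempty) (hK : ∀ S ∈ K, ¬ τ ⊆ S) (hfac : ∀ w ∈ τ, τ.erase w ∈ K)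
    (h : NC c (Rl K)) (hb : NC (c - 1) (Rl {S | S ⊂ τ})) : NC c (Rl (insert τ K)) := by
  set n : ℝ := (τ.card : ℝ) with hn
  have hnpos : 0 < n := by rw [hn]; exact_mod_cast hτ.card_pos
  set m : (V → ℝ) → ℝ := mn τ hτ with hm
  have hmc : Continuous m := continuous_mn τ hτ
  set X := Rl (insert τ K) with hX
  set U : Set (V → ℝ) := {x | n * m x < 1} with hUdef
  set W : Set (V → ℝ) := {x | 0 < m x} with hWdef
  have hU : IsOpen U := isOpen_lt (by fun_prop) continuous_const
  have hW : IsOpen W := isOpen_lt continuous_const hmc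
  have hm0 : ∀ S ∈ K, ∀ x ∈ sx S, m x = 0 := fun S hS x hx => mn_eq_zero hτ hx (hK S hS)
  have hcases : ∀ x ∈ X, (∃ S ∈ K, x ∈ sx S) ∨ x ∈ sx τ := by
    rintro x ⟨S, hS, hx⟩
    rcases hS with rfl | hS
    · exact Or.inr hx
    · exact Or.inl ⟨S, hS, hx⟩
  have hXW : X ∩ W = sx τ ∩ W := by
    ext x
    constructor
    · rintro ⟨hx, hxW⟩
      rcases hcases x hx with ⟨S, hS, hxS⟩ | hxτ
      · have : 0 < m x := hxW
        rw [hm0 S hS x hxS] at this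
        exact absurd this (lt_irrefl _)
      · exact ⟨hxτ, hxW⟩
    · rintro ⟨hx, hxW⟩
      exact ⟨⟨τ, Or.inl rfl, hx⟩, hxW⟩
  have hWiff : ∀ x, x ∈ W ↔ ∀ w ∈ τ, 0 < x w := by
    intro x
    show (0 : ℝ) < τ.inf' hτ x ↔ _
    rw [Finset.lt_inf'_iff]
  have hUof : ∀ x w, w ∈ τ → n * x w < 1 → x ∈ U := by
    intro x w hw hlt
    have : m x ≤ x w := mn_le hτ x hw
    show n * m x < 1
    nlinarith
  have hWconv : Convex ℝ W := by
    intro x hx y hy a b ha hb hab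
    rw [hWiff] at hx hy ⊢
    intro w hw
    have h1 := hx w hw
    have h2 := hy w hw
    simp only [Pi.add_apply, Pi.smul_apply, smul_eq_mul]
    rcases ha.lt_or_eq with h | h
    · have := mul_pos h h1
      have := mul_nonneg hb h2.le
      linarith
    · have hb1 : b = 1 := by linarith
      rw [← h, hb1]; linarith
  set φ : (V → ℝ) → (V → ℝ) := fun x μ =>
    (1 - n * m x)⁻¹ * (x μ - if μ ∈ τ then m x else 0) with hφ
  have hφc : ContinuousOn φ U := by
    refine continuousOn_pi.mpr fun μ => ?_
    refine ContinuousOn.mul (ContinuousOn.inv₀ (Continuous.continuousOn (by fun_prop)) ?_) ?_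
    · intro x hx
      have : n * m x < 1 := hx
      linarith
    · by_cases h1 : μ ∈ τ <;> simp only [h1, if_true, if_false] <;>
        exact Continuous.continuousOn (by fun_prop)
  have hφid : ∀ x, m x = 0 → φ x = x := by
    intro x hx
    funext μ
    simp [hφ, hx]
  have hφτ : ∀ x ∈ sx τ, x ∈ U → φ x ∈ sx τ ∧ ∃ w ∈ τ, φ x w = 0 ∧ x w = m x := by
    intro x hx hxU
    have hlt : 0 < 1 - n * m x := by
      have : n * m x < 1 := hxU
      linarith
    refine ⟨⟨fun μ => ?_, fun μ hμ => ?_, ?_⟩, ?_⟩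
    · refine mul_nonneg (inv_nonneg.mpr hlt.le) ?_
      by_cases h1 : μ ∈ τ
      · simp only [h1, if_true]
        have : m x ≤ x μ := mn_le hτ x h1
        linarith
      · simp only [h1, if_false]
        have := hx.1 μ
        linarith
    · by_contra h1
      have h3 : x μ = 0 := by by_contra h'; exact h1 (hx.2.1 μ h')
      simp [hφ, h1, h3] at hμ
    · simp only [hφ]
      rw [← Finset.mul_sum, Finset.sum_sub_distrib, hx.2.2,
        Finset.sum_congr rfl (g := fun _ => m x) (fun μ hμ => by rw [if_pos hμ])]
      simp only [Finset.sum_const, nsmul_eq_mul]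
      exact inv_mul_cancel₀ hlt.ne'
    · obtain ⟨w, hw, hwm⟩ := exists_mn hτ x
      refine ⟨w, hw, ?_, hwm⟩
      have : x w = m x := hwm
      simp [hφ, hw, this]
  refine NC.glue hU hW ?_ ?_ ?_ ?_
  · intro x _
    by_cases h0 : 0 < m x
    · exact Or.inr h0
    · left
      show n * m x < 1
      nlinarith
  · rw [hXW]
    exact (sx_convex τ).inter hWconv
  · refine h.dom φ id (hφc.mono inter_subset_right) continuousOn_id ?_ ?_ ?_
    · rintro x ⟨hx, hxU⟩
      rcases hcases x hx with ⟨S, hS, hxS⟩ | hxτ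
      · rw [hφid x (hm0 S hS x hxS)]; exact ⟨S, hS, hxS⟩
      · obtain ⟨h1, w, hw, h2, -⟩ := hφτ x hxτ hxU
        exact ⟨_, hfac w hw, sx_erase h1 h2⟩
    · rintro x ⟨S, hS, hxS⟩
      refine ⟨⟨S, Or.inr hS, hxS⟩, ?_⟩
      show n * m x < 1
      rw [hm0 S hS x hxS]; simp
    · rintro x ⟨hx, hxU⟩ t h0 h1
      rcases hcases x hx with ⟨S, hS, hxS⟩ | hxτ
      · rw [hφid x (hm0 S hS x hxS), id, seg_self]; exact ⟨hx, hxU⟩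
      · obtain ⟨k1, w, hw, k2, k3⟩ := hφτ x hxτ hxU
        refine ⟨⟨τ, Or.inl rfl, sx_seg hxτ k1 h0 h1⟩, hUof _ w hw ?_⟩
        have : n * m x < 1 := hxU
        have hm0 : 0 ≤ m x := mn_nonneg hτ hxτ.1
        simp only [Pi.add_apply, Pi.smul_apply, smul_eq_mul, id, k2, k3]
        have : t * m x ≤ m x := by nlinarith
        nlinarith
  · set ψ : (V → ℝ) → (V → ℝ) := fun b μ => b μ / 2 + if μ ∈ τ then 1 / (2 * n) else 0 with hψ
    have hψc : Continuous ψ := by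
      refine continuous_pi fun μ => ?_
      simp only [hψ]
      fun_prop
    have hψτ : ∀ b ∈ sx τ, ψ b ∈ sx τ ∧ ψ b ∈ W := by
      intro b hb
      have hpos : 0 < 1 / (2 * n) := by positivity
      refine ⟨⟨fun μ => ?_, fun μ hμ => ?_, ?_⟩, ?_⟩
      · have := hb.1 μ
        by_cases h1 : μ ∈ τ <;> simp only [hψ, h1, if_true, if_false] <;> linarith
      · by_contra h1
        have h3 : b μ = 0 := by by_contra h'; exact h1 (hb.2.1 μ h')
        simp [hψ, h1, h3] at hμ
      · simp only [hψ]
        rw [Finset.sum_add_distrib, ← Finset.sum_div, hb.2.2,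
          Finset.sum_congr rfl (g := fun _ => 1 / (2 * n)) (fun μ hμ => by rw [if_pos hμ])]
        simp only [Finset.sum_const, nsmul_eq_mul]
        rw [← hn]
        field_simp
        norm_num
      · rw [hWiff]
        intro w hw
        have := hb.1 w
        simp only [hψ, hw, if_true]; linarith
    have hψ0 : ∀ b w, w ∈ τ → b w = 0 → n * ψ b w = 1 / 2 := by
      intro b w hw h0
      simp only [hψ, hw, h0, if_true]
      field_simp
      norm_num
    rw [hXW]
    refine hb.dom φ ψ (hφc.mono fun x hx => hx.1.2) hψc.continuousOn ?_ ?_ ?_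
    · rintro x ⟨⟨hx, hxU⟩, hxτ, hxW⟩
      obtain ⟨k1, w, hw, k2, k3⟩ := hφτ x hxτ hxU
      exact ⟨_, Finset.erase_ssubset hw, sx_erase k1 k2⟩
    · rintro b ⟨S, hS, hbS⟩
      have hS' : S ⊂ τ := hS
      have hbτ := sx_mono hS'.1 hbS
      obtain ⟨w, hw, hwS⟩ := Finset.exists_of_ssubset hS'
      have hb0 : b w = 0 := by by_contra h'; exact hwS (hbS.2.1 w h')
      refine ⟨⟨⟨τ, Or.inl rfl, (hψτ b hbτ).1⟩, hUof _ w hw ?_⟩, hψτ b hbτ⟩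
      rw [hψ0 b w hw hb0]; norm_num
    · rintro x ⟨⟨hx, hxU⟩, hxτ, hxW⟩ t h0 h1
      obtain ⟨k1, w, hw, k2, k3⟩ := hφτ x hxτ hxU
      have hz := sx_seg hxτ (hψτ _ k1).1 h0 h1
      refine ⟨⟨⟨τ, Or.inl rfl, hz⟩, hUof _ w hw ?_⟩, hz,
        hWconv hxW (hψτ _ k1).2 h0 (by linarith) (by ring)⟩
      have e1 := hψ0 _ w hw k2
      have e2 : n * m x < 1 := hxU
      simp only [Pi.add_apply, Pi.smul_apply, smul_eq_mul, k3]
      have : n * (t * m x + (1 - t) * ψ (φ x) w) = t * (n * m x) + (1 - t) * (1 / 2) := by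
        rw [← e1]; ring
      rw [this]
      rcases h0.lt_or_eq with h | h
      · have := mul_lt_mul_of_pos_left e2 h
        linarith
      · rw [← h]; norm_num

/-- The boundary of a simplex with `n + 1` vertices is `(n-2)`-connected. -/
theorem NC.sphere {V : Type} (n : ℕ) : ∀ τ : Finset V, τ.card = n + 1 →
    NC n (Rl {S | S ⊂ τ}) := by
  induction n with
  | zero => intro τ _ ι _ hι; exact absurd hι (by simp)
  | succ n ih =>
    intro τ hτ
    obtain ⟨v, hv⟩ : τ.Nonempty := Finset.card_pos.mp (by omega)
    set σ := τ.erase v with hσ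
    have hσc : σ.card = n + 1 := by rw [hσ, Finset.card_erase_of_mem hv, hτ]; rfl
    set H : Set (Finset V) := {S | S ⊂ τ ∧ S ≠ σ} with hH
    have hσS : ∀ S ∈ H, ¬ σ ⊆ S := by
      rintro S ⟨h1, h2⟩ h3
      apply h2
      have hlt := Finset.card_lt_card h1
      exact (Finset.eq_of_subset_of_card_le h3 (by omega)).symm
    have hbd : {S | S ⊂ τ} = insert σ H := by
      ext S
      simp only [mem_ofPred_eq, mem_insert_iff, hH]
      constructor
      · intro h
        by_cases h' : S = σ
        · exact Or.inl h'
        · exact Or.inr ⟨h, h'⟩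
      · rintro (rfl | h)
        · exact Finset.erase_ssubset hv
        · exact h.1
    rw [hbd]
    have hins : ∀ S ∈ H, insert v S ∈ H := by
      rintro S ⟨h1, h2⟩
      refine ⟨⟨Finset.insert_subset hv h1.1, ?_⟩, ?_⟩
      · intro h3
        refine hσS S ⟨h1, h2⟩ ?_
        intro w hw
        have hw' := Finset.mem_erase.mp hw
        exact (Finset.mem_insert.mp (h3 hw'.2)).resolve_left hw'.1
      · intro h
        have : v ∈ σ := h ▸ Finset.mem_insert_self v S
        simp [hσ] at this
    refine NC.attach (Finset.card_pos.mp (by omega)) hσS ?_ ?_ (ih σ hσc)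
    · intro w hw
      refine ⟨(Finset.erase_ssubset hw).trans (Finset.erase_ssubset hv), ?_⟩
      exact (Finset.erase_ssubset hw).ne
    · have h0 : ({v} : Finset V) ∈ H := by
        refine ⟨?_, ?_⟩
        · refine ⟨by simpa using hv, fun h => ?_⟩
          have := Finset.card_le_card h
          simp at this; omega
        · intro h
          have : v ∈ σ := h ▸ Finset.mem_singleton_self v
          simp [hσ] at this
      refine NC.star (Pi.single v 1) ⟨{v}, h0, single_mem_sx (by simp)⟩ ?_
      rintro x ⟨S, hS, hx⟩ t t0 t1
      exact ⟨insert v S, hins S hS, sx_seg (sx_mono (Finset.subset_insert _ _) hx)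
        (single_mem_sx (by simp)) t0 t1⟩

end ASG

namespace ASG
open Metric Set

/-- Hypotheses of the matching argument at the face `S`. -/
def MH {V R : Type} [DecidableEq V] [PartialOrder R] (q : ℕ) (ρ : Finset V → R) (tg : Finset V → Option V)
    (K : Finset (Finset V)) (S : Finset V) : Prop :=
  (tg S = none → q ≤ S.card ∧ ∀ w ∈ S, ρ (S.erase w) < ρ S) ∧
  ∀ v, tg S = some v → insert v S ∈ K ∧ tg (insert v S) = some v ∧ tg (S.erase v) = some v ∧
    ρ (insert v S) = ρ S ∧ ρ (S.erase v) = ρ S ∧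
    (v ∈ S → ∀ w ∈ S, w ≠ v → ρ (S.erase w) < ρ S)

theorem MH.facet {V R : Type} [PartialOrder R] {q : ℕ} {ρ : Finset V → R}
    {tg : Finset V → Option V} {K : Finset (Finset V)}
    (hdown : ∀ S ∈ K, ∀ T, T ⊆ S → T ∈ K) (hM : ∀ S ∈ K, MH q ρ tg K S) (N : ℕ) :
    ∀ S ∈ K, (K.filter fun T => ρ T < ρ S).card < N → ∀ w ∈ S, tg S ≠ some w →
      ρ (S.erase w) < ρ S := by
  induction N with
  | zero => intro S _ h; exact absurd h (by omega)
  | succ N ih =>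
    intro S hS hN w hw hne
    cases ht : tg S with
    | none => exact ((hM S hS).1 ht).2 w hw
    | some v =>
      have hwv : w ≠ v := by rintro rfl; exact hne ht
      obtain ⟨h1, h2, h3, h4, h5, h6⟩ := (hM S hS).2 v ht
      by_cases hv : v ∈ S
      · exact h6 hv w hw hwv
      · obtain ⟨-, -, -, -, -, h6'⟩ := (hM _ h1).2 v h2
        have hlt := h6' (Finset.mem_insert_self _ _) w (Finset.mem_insert_of_mem hw) hwv
        rw [h4] at hlt
        set S' := (insert v S).erase w with hS'
        have hS'K : S' ∈ K := hdown _ h1 _ (Finset.erase_subset _ _)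
        have hvS' : v ∈ S' := Finset.mem_erase.mpr ⟨hwv.symm, Finset.mem_insert_self _ _⟩
        have he : S'.erase v = S.erase w := by
          rw [hS', Finset.erase_right_comm, Finset.erase_insert hv]
        rw [← he]
        by_cases ht' : tg S' = some v
        · obtain ⟨-, -, -, -, h5', -⟩ := (hM _ hS'K).2 v ht'
          rw [h5']; exact hlt
        · refine (ih S' hS'K ?_ v hvS' ht').trans hlt
          refine lt_of_lt_of_le (Finset.card_lt_card (Finset.ssubset_iff_of_subset ?_ |>.mpr ?_))
            (Nat.lt_succ_iff.mp hN)
          · intro T hT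
            rw [Finset.mem_filter] at hT ⊢
            exact ⟨hT.1, hT.2.trans hlt⟩
          · exact ⟨S', Finset.mem_filter.mpr ⟨hS'K, hlt⟩, by simp⟩

/-- Discrete-Morse type connectivity criterion. -/
theorem NC.morse {V R : Type} [PartialOrder R] {q : ℕ} {ρ : Finset V → R}
    {tg : Finset V → Option V} (N : ℕ) : ∀ K : Finset (Finset V), K.card = N → K.Nonempty →
    (∀ S ∈ K, ∀ T, T ⊆ S → T ∈ K) → (∀ S ∈ K, MH q ρ tg K S) → NC q (Rl (K : Set (Finset V))) := by
  induction N using Nat.strong_induction_on with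
  | _ N ih =>
  intro K hKN hKne hdown hM
  rcases Nat.eq_zero_or_pos q with rfl | hq
  · intro ι _ hι; exact absurd hι (by simp)
  have hfac : ∀ S ∈ K, ∀ w ∈ S, tg S ≠ some w → ρ (S.erase w) < ρ S :=
    fun S hS => MH.facet hdown hM _ S hS (Nat.lt_succ_self _)
  obtain ⟨S0, hS0, hmax⟩ := Finset.exists_maximalFor ρ K hKne
  have hmax' : ∀ T ∈ K, ¬ ρ S0 < ρ T := fun T hT h => absurd (hmax hT h.le) (not_le_of_gt h)
  have hcov : ∀ S ∈ K, ρ S = ρ S0 → ∀ w, w ∉ S → insert w S ∈ K → tg S = some w := by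
    intro S hS hρ w hw hi
    have ht : tg (insert w S) = some w := by
      by_contra hne
      have := hfac _ hi w (Finset.mem_insert_self _ _) hne
      rw [Finset.erase_insert hw, hρ] at this
      exact hmax' _ hi this
    obtain ⟨-, -, h3, -⟩ := (hM _ hi).2 w ht
    rwa [Finset.erase_insert hw] at h3
  cases ht : tg S0 with
  | none =>
    have htop : ∀ S ∈ K, S0 ⊆ S → S = S0 := by
      intro S hS hsub
      by_contra hne
      obtain ⟨w, hw, hw0⟩ := Finset.exists_of_ssubset
        ((Finset.ssubset_iff_subset_ne).mpr ⟨hsub, fun h => hne h.symm⟩)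
      have := hcov S0 hS0 rfl w hw0 (hdown S hS _ (Finset.insert_subset hw hsub))
      rw [ht] at this; exact absurd this (by simp)
    have hq0 := ((hM S0 hS0).1 ht).1
    have hS0ne : S0.Nonempty := Finset.card_pos.mp (by omega)
    have hcard : (K.erase S0).card < N := by
      rw [← hKN]; exact Finset.card_erase_lt_of_mem hS0
    have hK' : NC q (Rl ((K.erase S0 : Finset (Finset V)) : Set (Finset V))) := by
      refine ih _ hcard _ rfl ?_ ?_ ?_
      · refine ⟨∅, Finset.mem_erase.mpr ⟨fun h => ?_, hdown S0 hS0 _ (Finset.empty_subset _)⟩⟩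
        rw [← h] at hS0ne; exact Finset.not_nonempty_empty hS0ne
      · intro S hS T hT
        rw [Finset.mem_erase] at hS ⊢
        refine ⟨?_, hdown S hS.2 T hT⟩
        rintro rfl
        exact hS.1 (htop S hS.2 hT)
      · intro S hS
        have hS' := Finset.mem_erase.mp hS
        obtain ⟨m1, m2⟩ := hM S hS'.2
        refine ⟨m1, fun v hv => ?_⟩
        obtain ⟨h1, h2, h3⟩ := m2 v hv
        refine ⟨Finset.mem_erase.mpr ⟨fun h => ?_, h1⟩, h2, h3⟩
        rw [h, ht] at h2; exact absurd h2 (by simp)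
    have := NC.attach (τ := S0) hS0ne (fun S hS hsub => ?_) (fun w hw => ?_) hK'
      ((NC.sphere (S0.card - 1) S0 (by omega)).mono (by omega))
    · have e : (K : Set (Finset V)) = insert S0 ((K.erase S0 : Finset (Finset V)) : Set _) := by
        rw [← Finset.coe_insert, Finset.insert_erase hS0]
      rw [e]; exact this
    · have hS' := Finset.mem_erase.mp (Finset.mem_coe.mp hS)
      exact hS'.1 (htop S hS'.2 hsub)
    · refine Finset.mem_coe.mpr (Finset.mem_erase.mpr ⟨(Finset.erase_ssubset hw).ne,
        hdown S0 hS0 _ (Finset.erase_subset _ _)⟩)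
  | some v =>
    obtain ⟨h1, h2, h3, h4, h5, -⟩ := (hM S0 hS0).2 v ht
    set τ := insert v S0 with hτ
    set σ := S0.erase v with hσ
    have hτσ : τ = insert v σ := by
      ext x; simp only [hτ, hσ, Finset.mem_insert, Finset.mem_erase]; tauto
    have hvσ : v ∉ σ := by simp [hσ]
    have hσK : σ ∈ K := hdown S0 hS0 _ (Finset.erase_subset _ _)
    have hsub : ∀ S ∈ K, σ ⊆ S → S = σ ∨ S = τ := by
      intro S hS hle
      have hST : S ⊆ τ := by
        intro w hw
        by_contra hwτ
        have hwσ : w ∉ σ := fun h => hwτ (hτσ ▸ Finset.mem_insert_of_mem h)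
        have := hcov σ hσK h5 w hwσ (hdown S hS _ (Finset.insert_subset hw hle))
        rw [h3] at this
        have : v = w := by simpa using this
        exact hwτ (this ▸ Finset.mem_insert_self _ _)
      by_cases hvS : v ∈ S
      · right
        refine Finset.Subset.antisymm hST ?_
        rw [hτσ]; exact Finset.insert_subset hvS hle
      · left
        refine Finset.Subset.antisymm (fun w hw => ?_) hle
        have := hST hw
        rw [hτσ, Finset.mem_insert] at this
        exact this.resolve_left (by rintro rfl; exact hvS hw)
    have hστ : σ ≠ τ := by
      intro h; exact hvσ (h ▸ Finset.mem_insert_self _ _)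
    rcases σ.eq_empty_or_nonempty with hσe | hσne
    · refine NC.star (Pi.single v 1) ⟨τ, h1, single_mem_sx (Finset.mem_insert_self _ _)⟩ ?_
      rintro x ⟨S, hS, hx⟩ t t0 t1
      refine ⟨τ, h1, sx_seg (sx_mono ?_ hx) (single_mem_sx (Finset.mem_insert_self _ _)) t0 t1⟩
      rcases hsub S hS (by rw [hσe]; exact Finset.empty_subset _) with h | h
      · rw [h, hσe]; exact Finset.empty_subset _
      · rw [h]
    · set K' := (K.erase σ).erase τ with hK'
      have hmem : ∀ S, S ∈ K' ↔ S ∈ K ∧ S ≠ σ ∧ S ≠ τ := by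
        intro S; simp only [hK', Finset.mem_erase]; tauto
      have hcard : K'.card < N := by
        rw [← hKN]
        refine Finset.card_lt_card (Finset.ssubset_iff_of_subset ?_ |>.mpr ⟨σ, hσK, ?_⟩)
        · intro S hS; exact ((hmem S).mp hS).1
        · intro h; exact ((hmem σ).mp h).2.1 rfl
      have hnot : ∀ S ∈ K', ¬ σ ⊆ S := by
        intro S hS hle
        obtain ⟨k1, k2, k3⟩ := (hmem S).mp hS
        rcases hsub S k1 hle with h | h
        · exact k2 h
        · exact k3 h
      have hNC : NC q (Rl (K' : Set (Finset V))) := by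
        refine ih _ hcard _ rfl ?_ ?_ ?_
        · refine ⟨∅, (hmem _).mpr ⟨hdown S0 hS0 _ (Finset.empty_subset _), ?_, ?_⟩⟩
          · exact hσne.ne_empty.symm
          · exact (Finset.insert_ne_empty _ _).symm
        · intro S hS T hT
          refine (hmem T).mpr ⟨hdown S ((hmem S).mp hS).1 T hT, ?_, ?_⟩
          · rintro rfl; exact hnot S hS hT
          · rintro rfl
            exact hnot S hS ((hτσ ▸ Finset.subset_insert v σ : σ ⊆ τ).trans hT)
        · intro S hS
          obtain ⟨k1, k2, k3⟩ := (hmem S).mp hS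
          obtain ⟨m1, m2⟩ := hM S k1
          refine ⟨m1, fun u hu => ?_⟩
          obtain ⟨g1, g2, g3⟩ := m2 u hu
          refine ⟨(hmem _).mpr ⟨g1, fun h => ?_, fun h => ?_⟩, g2, g3⟩
          · rw [h, h3] at g2
            have huv : v = u := by simpa using g2
            subst huv
            exact hvσ (h ▸ Finset.mem_insert_self _ _)
          · rw [h, h2] at g2
            have huv : v = u := by simpa using g2
            subst huv
            refine hnot S hS ?_
            intro w hw
            have : w ∈ insert v S := by rw [h, hτσ]; exact Finset.mem_insert_of_mem hw
            rw [Finset.mem_insert] at this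
            exact this.resolve_left (by rintro rfl; exact hvσ hw)
      have hfin := NC.collapse (v := v) hσne hvσ hnot (fun w hw => ?_) hNC
      · have e : (K : Set (Finset V)) = insert σ (insert (insert v σ) (K' : Set (Finset V))) := by
          ext S
          simp only [Set.mem_insert_iff, Finset.mem_coe, hmem, ← hτσ]
          constructor
          · intro h; tauto
          · rintro (rfl | rfl | h)
            · exact hσK
            · exact h1
            · exact h.1
        rw [e]; exact hfin
      · refine (hmem _).mpr ⟨hdown τ h1 _ (hτσ ▸ Finset.erase_subset _ _), ?_, ?_⟩
        · intro h
          have : v ∈ σ := by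
            rw [← h]; exact Finset.mem_erase.mpr ⟨fun h' => hvσ (h' ▸ hw), Finset.mem_insert_self _ _⟩
          exact hvσ this
        · rw [hτσ]; exact (Finset.erase_ssubset (Finset.mem_insert_of_mem hw)).ne

theorem NC.morse_dec {V R : Type} [inst : DecidableEq V] [PartialOrder R] {q : ℕ}
    {ρ : Finset V → R} {tg : Finset V → Option V} (K : Finset (Finset V)) (hne : K.Nonempty)
    (hdown : ∀ S ∈ K, ∀ T, T ⊆ S → T ∈ K) (hM : ∀ S ∈ K, MH q ρ tg K S) :
    NC q (Rl (K : Set (Finset V))) := by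
  have h : inst = fun a b => Classical.propDecidable (a = b) := Subsingleton.elim _ _
  subst h
  exact NC.morse _ K rfl hne hdown hM

end ASG

namespace ASG
open Metric Set

/-- Exponent vectors of monomials in `z`. -/
abbrev Mon (n : ℕ) : Type := Fin n →₀ ℕ

/-- Generators together with a term order. -/
structure Ct (e n : ℕ) where
  /-- generators -/
  α : Fin n → M e
  hα : ∀ i, α i ≠ 0
  /-- term order -/
  ord : LinearOrder (Mon n)
  tord : IsTermOrder ord

namespace Ct

variable {e n : ℕ} (C : Ct e n)

/-- weak order -/
def le (a b : Mon n) : Prop := C.ord.le a b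

/-- strict order -/
def lt (a b : Mon n) : Prop := C.ord.lt a b

theorem le_refl (a : Mon n) : C.le a a := C.ord.le_refl a
theorem le_antisymm {a b : Mon n} (h : C.le a b) (h' : C.le b a) : a = b :=
  C.ord.le_antisymm _ _ h h'
theorem le_trans {a b c : Mon n} (h : C.le a b) (h' : C.le b c) : C.le a c :=
  C.ord.le_trans _ _ _ h h'
theorem lt_iff {a b : Mon n} : C.lt a b ↔ C.le a b ∧ ¬ C.le b a := C.ord.lt_iff_le_not_ge a b
theorem le_total (a b : Mon n) : C.le a b ∨ C.le b a := C.ord.le_total a b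
theorem not_le {a b : Mon n} : ¬ C.le a b ↔ C.lt b a := by
  rw [lt_iff]
  constructor
  · intro h; exact ⟨(C.le_total a b).resolve_left h, h⟩
  · intro h; exact h.2
theorem lt_irrefl (a : Mon n) : ¬ C.lt a a := fun h => (C.lt_iff.mp h).2 (C.le_refl a)
theorem lt_of_le_ne {a b : Mon n} (h : C.le a b) (h' : a ≠ b) : C.lt a b :=
  C.lt_iff.mpr ⟨h, fun h2 => h' (C.le_antisymm h h2)⟩
theorem lt_of_le_lt {a b c : Mon n} (h : C.le a b) (h' : C.lt b c) : C.lt a c := by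
  rw [lt_iff] at *
  exact ⟨C.le_trans h h'.1, fun h2 => h'.2 (C.le_trans h2 h)⟩
theorem lt_trans {a b c : Mon n} (h : C.lt a b) (h' : C.lt b c) : C.lt a c :=
  C.lt_of_le_lt (C.lt_iff.mp h).1 h'
theorem add_le {a b : Mon n} (c : Mon n) (h : C.le a b) : C.le (a + c) (b + c) := C.tord.2 a b c h
theorem add_lt {a b : Mon n} (c : Mon n) (h : C.lt a b) : C.lt (a + c) (b + c) := by
  refine C.lt_of_le_ne (C.add_le c (C.lt_iff.mp h).1) fun h' => ?_
  have := add_right_cancel h'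
  subst this
  exact C.lt_irrefl _ h
theorem lt_of_add_lt {a b : Mon n} (c : Mon n) (h : C.lt (a + c) (b + c)) : C.lt a b := by
  rw [← C.not_le]
  intro h2
  exact C.not_le.mpr h (C.add_le c h2)
theorem le_of_le {a b : Mon n} (h : a ≤ b) : C.le a b := by
  have := C.add_le a (C.tord.1 (b - a))
  rwa [zero_add, tsub_add_cancel_of_le h] at this

/-- least element of a set of monomials -/
def lst (P : Set (Mon n)) : Mon n :=
  if h : ∃ a ∈ P, ∀ b ∈ P, C.le a b then h.choose else 0

theorem lst_spec {P : Set (Mon n)} (hf : P.Finite) (hne : P.Nonempty) :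
    C.lst P ∈ P ∧ ∀ b ∈ P, C.le (C.lst P) b := by
  have h : ∃ a ∈ P, ∀ b ∈ P, C.le a b := @Set.exists_min_image _ _ C.ord P id hf hne
  unfold lst
  rw [dif_pos h]
  exact h.choose_spec

/-- The map on exponent vectors. -/
def ph : Mon n →ₗ[ℕ] M e := Finsupp.linearCombination ℕ C.α

theorem ph_single (i : Fin n) (c : ℕ) : C.ph (Finsupp.single i c) = c • C.α i := by
  simp [ph]

theorem degree_le (m : Mon n) : m.degree ≤ (C.ph m).degree := by
  induction m using Finsupp.induction_linear with
  | zero => simp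
  | add a b ha hb => simp only [map_add]; omega
  | single i c =>
    rw [ph_single, map_nsmul, Finsupp.degree_single, smul_eq_mul]
    have : (C.α i).degree ≠ 0 := by
      rw [Ne, Finsupp.degree_eq_zero_iff]; exact C.hα i
    exact Nat.le_mul_of_pos_right _ (Nat.pos_of_ne_zero this)

theorem ph_eq_zero {m : Mon n} (h : C.ph m = 0) : m = 0 := by
  have := C.degree_le m
  rw [h] at this
  rw [← Finsupp.degree_eq_zero_iff]
  simpa using this

theorem ph_mem (m : Mon n) : C.ph m ∈ sg C.α := by
  induction m using Finsupp.induction_linear with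
  | zero => simp
  | add a b ha hb => rw [map_add]; exact add_mem ha hb
  | single i c =>
    rw [ph_single]
    have h : C.α i ∈ sg C.α := AddSubmonoid.subset_closure (Set.mem_range_self i)
    exact nsmul_mem h c

theorem exists_ph {x : M e} (hx : x ∈ sg C.α) : ∃ m, C.ph m = x := by
  induction hx using AddSubmonoid.closure_induction with
  | mem x hx =>
    obtain ⟨i, rfl⟩ := hx
    exact ⟨Finsupp.single i 1, by rw [ph_single, one_smul]⟩
  | zero => exact ⟨0, map_zero _⟩
  | add x y _ _ hx hy =>
    obtain ⟨a, rfl⟩ := hx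
    obtain ⟨b, rfl⟩ := hy
    exact ⟨a + b, map_add _ _ _⟩

/-- Standard monomials. -/
def St (m : Mon n) : Prop := ∀ m', C.ph m' = C.ph m → C.le m m'

/-- Normal form. -/
def NF (m : Mon n) : Mon n := C.lst {m' | C.ph m' = C.ph m}

theorem NF_spec (m : Mon n) : C.ph (C.NF m) = C.ph m ∧ ∀ m', C.ph m' = C.ph m →
    C.le (C.NF m) m' := by
  refine C.lst_spec (P := {m' | C.ph m' = C.ph m}) ?_ ⟨m, rfl⟩
  refine (Finsupp.finite_of_degree_le (C.ph m).degree).subset ?_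
  intro m' hm'
  have hm'' : C.ph m' = C.ph m := hm'
  show m'.degree ≤ _
  rw [← hm'']; exact C.degree_le m'

theorem ph_NF (m : Mon n) : C.ph (C.NF m) = C.ph m := (C.NF_spec m).1
theorem NF_le (m : Mon n) : C.le (C.NF m) m := (C.NF_spec m).2 m rfl
theorem St_NF (m : Mon n) : C.St (C.NF m) := fun m' h => (C.NF_spec m).2 m' (h.trans (C.ph_NF m))
theorem St.eq {a b : Mon n} (ha : C.St a) (hb : C.St b) (h : C.ph a = C.ph b) : a = b :=
  C.le_antisymm (ha b h.symm) (hb a h)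
theorem St.NF {a : Mon n} (ha : C.St a) : C.NF a = a := St.eq C (C.St_NF a) ha (C.ph_NF a)
theorem NF_ne_zero {m : Mon n} (h : m ≠ 0) : C.NF m ≠ 0 := by
  intro h0
  apply h
  apply C.ph_eq_zero
  rw [← C.ph_NF, h0, map_zero]
theorem NF_lt {m : Mon n} (h : ¬ C.St m) : C.lt (C.NF m) m :=
  C.lt_of_le_ne (C.NF_le m) fun h' => h (h' ▸ C.St_NF m)

theorem St.mono {a b : Mon n} (hb : C.St b) (h : a ≤ b) : C.St a := by
  intro m' hm'
  by_contra hc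
  have h1 := C.add_lt (b - a) (C.not_le.mp hc)
  rw [add_tsub_cancel_of_le h] at h1
  refine C.not_le.mpr h1 (hb _ ?_)
  rw [map_add, hm', ← map_add, add_tsub_cancel_of_le h]

/-- Least element of `I` dividing `m`. -/
def fs (I : Set (Mon n)) (m : Mon n) : Mon n := C.lst {x | x ∈ I ∧ x ≤ m}

theorem fs_spec {I : Set (Mon n)} {m : Mon n} (h : m ∈ I) :
    C.fs I m ∈ I ∧ C.fs I m ≤ m ∧ ∀ x ∈ I, x ≤ m → C.le (C.fs I m) x := by
  have := C.lst_spec (P := {x | x ∈ I ∧ x ≤ m}) ((Set.finite_Iic m).subset fun x hx => hx.2)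
    ⟨m, h, _root_.le_refl m⟩
  exact ⟨this.1.1, this.1.2, fun x h1 h2 => this.2 x ⟨h1, h2⟩⟩

/-- The next state. -/
def nx (I : Set (Mon n)) (g : Mon n) : Set (Mon n) :=
  {m | ¬ C.St (g + m) ∨ ∃ x ∈ I, C.lt x g ∧ x ≤ g + m}

/-- Degree bound for nonstandard monomials. -/
def DB (d : ℕ) : Prop := ∀ m, ¬ C.St m → ∃ h, h ≤ m ∧ ¬ C.St h ∧ h.degree ≤ d

/-- Valid states. -/
def Va (d : ℕ) (I : Set (Mon n)) : Prop :=
  (∀ a ∈ I, ∀ b, a ≤ b → b ∈ I) ∧ (0 : Mon n) ∉ I ∧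
    ∀ m ∈ I, C.St m → ∃ x ∈ I, x ≤ m ∧ x.degree + 1 ≤ d

theorem Va.fs_degree {d : ℕ} {I : Set (Mon n)} (hI : C.Va d I) {m : Mon n} (hm : m ∈ I)
    (hs : C.St m) : (C.fs I m).degree + 1 ≤ d := by
  obtain ⟨h1, h2, h3⟩ := C.fs_spec hm
  obtain ⟨x, hx, hxl, hxd⟩ := hI.2.2 _ h1 (hs.mono C h2)
  have : x = C.fs I m := C.le_antisymm (C.le_of_le hxl) (h3 x hx (hxl.trans h2))
  rwa [this] at hxd

theorem Va.next {d : ℕ} (hDB : C.DB d) {I : Set (Mon n)} (hI : C.Va d I) {m : Mon n} (hm : m ∈ I)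
    (hs : C.St m) : C.Va d (C.nx I (C.fs I m)) := by
  obtain ⟨h1, h2, h3⟩ := C.fs_spec hm
  set g := C.fs I m with hg
  refine ⟨?_, ?_, ?_⟩
  · rintro a ha b hab
    rcases ha with ha | ⟨x, hx, hxg, hxl⟩
    · exact Or.inl fun hb => ha (hb.mono C (add_le_add_right hab g))
    · exact Or.inr ⟨x, hx, hxg, hxl.trans (add_le_add_right hab g)⟩
  · rintro (h | ⟨x, hx, hxg, hxl⟩)
    · rw [add_zero] at h; exact h (hs.mono C h2)
    · rw [add_zero] at hxl
      exact C.not_le.mpr hxg (h3 x hx (hxl.trans h2))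
  · intro a ha hsa
    by_cases hst : C.St (g + a)
    · rcases ha with ha | ⟨x, hx, hxg, hxl⟩
      · exact absurd hst ha
      · obtain ⟨y, hy, hyx, hyd⟩ := hI.2.2 x hx (hst.mono C hxl)
        refine ⟨y - g, Or.inr ⟨y, hy, C.lt_of_le_lt (C.le_of_le hyx) hxg, ?_⟩, ?_, ?_⟩
        · exact le_add_tsub
        · exact tsub_le_iff_left.mpr (hyx.trans hxl)
        · have : (y - g).degree ≤ y.degree := Finsupp.degree_mono tsub_le_self
          omega
    · obtain ⟨h, hle, hns, hd⟩ := hDB _ hst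
      have hle' : h - g ≤ a := tsub_le_iff_left.mpr hle
      refine ⟨h - g, Or.inl fun hc => hns (hc.mono C le_add_tsub), hle', ?_⟩
      have hl : (h - g).degree ≤ h.degree := Finsupp.degree_mono tsub_le_self
      have hne : (h - g).degree ≠ h.degree := by
        intro he
        have e1 : (h - g) + (h - (h - g)) = h := add_tsub_cancel_of_le tsub_le_self
        have e2 : (h - (h - g)).degree = 0 := by
          have := congrArg Finsupp.degree e1
          rw [map_add] at this; omega
        rw [Finsupp.degree_eq_zero_iff] at e2
        rw [e2, add_zero] at e1
        rw [e1] at hle'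
        exact hns (hsa.mono C hle')
      omega

/-- Initial state. -/
def I0 (n : ℕ) : Set (Mon n) := {m | m ≠ 0}

theorem exists_single_le {m : Mon n} (h : m ≠ 0) : ∃ i, Finsupp.single i 1 ≤ m := by
  obtain ⟨i, hi⟩ := Finsupp.ne_iff.mp h
  refine ⟨i, ?_⟩
  rw [Finsupp.single_le_iff]
  exact Nat.one_le_iff_ne_zero.mpr hi

theorem Va_I0 {d : ℕ} (hd : 2 ≤ d) : C.Va d (I0 n) := by
  refine ⟨?_, ?_, ?_⟩
  · rintro a ha b hab rfl
    exact ha (by simpa using hab)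
  · intro h; exact h rfl
  · intro m hm _
    obtain ⟨i, hi⟩ := exists_single_le hm
    refine ⟨_, ?_, hi, ?_⟩
    · show Finsupp.single i 1 ≠ 0
      simp
    · rw [Finsupp.degree_single]; omega

theorem fs_I0 {m : Mon n} (hm : m ∈ I0 n) : (C.fs (I0 n) m).degree = 1 := by
  obtain ⟨h1, h2, h3⟩ := C.fs_spec hm
  obtain ⟨i, hi⟩ := exists_single_le h1
  have : Finsupp.single i 1 = C.fs (I0 n) m := by
    refine C.le_antisymm (C.le_of_le hi) (h3 _ ?_ (hi.trans h2))
    show Finsupp.single i 1 ≠ 0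
    simp
  rw [← this, Finsupp.degree_single]

end Ct

end ASG

namespace ASG
open Metric Set
namespace Ct

variable {e n : ℕ} (C : Ct e n)

/-- Comparison of code letters. -/
def lr : Mon n ⊕ ℕ → Mon n ⊕ ℕ → Prop
  | Sum.inl a, Sum.inl b => C.lt a b
  | Sum.inl _, Sum.inr _ => True
  | Sum.inr _, Sum.inl _ => False
  | Sum.inr a, Sum.inr b => a < b

theorem lr_irrefl (x : Mon n ⊕ ℕ) : ¬ C.lr x x := by
  rcases x with x | x
  · exact C.lt_irrefl x
  · exact Nat.lt_irrefl x

theorem lr_trans {x y z : Mon n ⊕ ℕ} (h : C.lr x y) (h' : C.lr y z) : C.lr x z := by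
  rcases x with x | x <;> rcases y with y | y <;> rcases z with z | z <;>
    simp only [lr] at h h' ⊢
  · exact C.lt_trans h h'
  · exact Nat.lt_trans h h'

/-- Lexicographic comparison. -/
def cl : List (Mon n ⊕ ℕ) → List (Mon n ⊕ ℕ) → Prop
  | x :: xs, y :: ys => C.lr x y ∨ (x = y ∧ cl xs ys)
  | _, _ => False

theorem cl_irrefl : ∀ x : List (Mon n ⊕ ℕ), ¬ C.cl x x
  | [] => by simp [cl]
  | x :: xs => by
    simp only [cl, true_and, not_or]
    exact ⟨C.lr_irrefl x, cl_irrefl xs⟩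

theorem cl_trans : ∀ x y z : List (Mon n ⊕ ℕ), C.cl x y → C.cl y z → C.cl x z
  | [], _, _ => by simp [cl]
  | _ :: _, [], _ => by simp [cl]
  | _ :: _, _ :: _, [] => by simp [cl]
  | x :: xs, y :: ys, z :: zs => by
    simp only [cl]
    rintro (h | ⟨rfl, h⟩) (h' | ⟨rfl, h'⟩)
    · exact Or.inl (C.lr_trans h h')
    · exact Or.inl h
    · exact Or.inl h'
    · exact Or.inr ⟨rfl, cl_trans xs ys zs h h'⟩

/-- Ranks. -/
structure Rk (C : Ct e n) where
  /-- the code -/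
  l : List (Mon n ⊕ ℕ)

/-- Strict comparison of ranks. -/
def rlt (a b : Rk C) : Prop := C.cl a.l b.l

instance : IsStrictOrder (Rk C) (rlt C) where
  irrefl a := C.cl_irrefl a.l
  trans a b c := C.cl_trans a.l b.l c.l

instance : PartialOrder (Rk C) := partialOrderOfSO (rlt C)

theorem rk_lt {a b : Rk C} (h : C.cl a.l b.l) : a < b := h

/-- The code of a word in a given state. -/
def code : Set (Mon n) → List (Mon n) → List (Mon n ⊕ ℕ)
  | _, [] => []
  | I, m :: L =>
    if m ∈ I then
      if m = C.fs I m then Sum.inl m :: code (C.nx I m) L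
      else [Sum.inl (C.fs I m), Sum.inr L.length]
    else [Sum.inr L.length]

/-- The toggled vertex. -/
def tog : Set (Mon n) → List (Mon n) → Option (M e)
  | _, [] => none
  | I, m :: L =>
    if m ∈ I then
      if m = C.fs I m then (tog (C.nx I m) L).map (C.ph m + ·)
      else some (C.ph (C.fs I m))
    else some 0

/-- Words that are not lower elements of a pair. -/
def nl : Set (Mon n) → List (Mon n) → Prop
  | _, [] => True
  | I, m :: L => m ∉ I ∨ (m = C.fs I m ∧ nl (C.nx I m) L)

/-- Words of nonzero standard monomials. -/
def WF (L : List (Mon n)) : Prop := ∀ a ∈ L, a ≠ 0 ∧ C.St a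

/-- Merging two consecutive letters. -/
inductive Mrg : M e → List (Mon n) → List (Mon n) → Prop
  | here (a b : Mon n) (L : List (Mon n)) : Mrg (C.ph a) (a :: b :: L) (C.NF (a + b) :: L)
  | there (w : M e) (a : Mon n) (L L' : List (Mon n)) (h : Mrg w L L') :
      Mrg (C.ph a + w) (a :: L) (a :: L')

theorem Mrg.length {w : M e} {L L' : List (Mon n)} (h : C.Mrg w L L') :
    L'.length + 1 = L.length := by
  induction h with
  | here a b L => simp
  | there w a L L' h ih => simpa using ih

theorem WF.tail {a : Mon n} {L : List (Mon n)} (h : C.WF (a :: L)) : C.WF L :=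
  fun b hb => h b (List.mem_cons_of_mem _ hb)

theorem WF.cons {a : Mon n} {L : List (Mon n)} (h0 : a ≠ 0) (hs : C.St a) (h : C.WF L) :
    C.WF (a :: L) := by
  intro b hb
  rcases List.mem_cons.mp hb with rfl | hb
  · exact ⟨h0, hs⟩
  · exact h b hb

theorem Mrg.less {w : M e} {L L' : List (Mon n)} (h : C.Mrg w L L') :
    ∀ I : Set (Mon n), C.WF L → (∀ a ∈ I, ∀ b, a ≤ b → b ∈ I) → C.nl I L → C.tog I L ≠ some w →
      C.lt L'.sum L.sum ∨ (L'.sum = L.sum ∧ C.cl (C.code I L') (C.code I L)) := by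
  induction h with
  | here a b L =>
    intro I hW hup hnl htog
    by_cases hst : C.St (a + b)
    · right
      rw [hst.NF C]
      refine ⟨by simp [add_assoc], ?_⟩
      by_cases ha : a ∈ I
      · rcases hnl with h | ⟨hfa, hnl⟩
        · exact absurd ha h
        have hab : a + b ∈ I := hup a ha _ le_self_add
        have hb : b ∈ C.nx I a := by
          by_contra hb
          apply htog
          simp only [tog]
          rw [if_pos ha, if_pos hfa, if_neg hb]
          simp
        rcases hb with hb | ⟨x, hx, hxa, hxl⟩
        · exact absurd hst hb
        have hlt : C.lt (C.fs I (a + b)) a := C.lt_of_le_lt ((C.fs_spec hab).2.2 x hx hxl) hxa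
        simp only [code]
        rw [if_pos hab, if_pos ha, if_pos hfa]
        by_cases hc : a + b = C.fs I (a + b)
        · rw [if_pos hc]
          left
          show C.lt _ _
          rw [← hc] at hlt; exact hlt
        · rw [if_neg hc]
          left
          exact hlt
      · simp only [code]
        rw [if_neg ha]
        by_cases hab : a + b ∈ I
        · rw [if_pos hab]
          by_cases hc : a + b = C.fs I (a + b)
          · rw [if_pos hc]; left; trivial
          · rw [if_neg hc]; left; trivial
        · rw [if_neg hab]; left
          show _ < _
          simp
    · left
      have := C.add_lt L.sum (C.NF_lt hst)
      simpa [add_assoc] using this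
  | there w a L L' h ih =>
    intro I hW hup hnl htog
    by_cases ha : a ∈ I
    · rcases hnl with h' | ⟨hfa, hnl⟩
      · exact absurd ha h'
      have hup' : ∀ x ∈ C.nx I a, ∀ y, x ≤ y → y ∈ C.nx I a := by
        rintro x hx b hab
        rcases hx with hx | ⟨x', hx, hxg, hxl⟩
        · exact Or.inl fun hb => hx (hb.mono C (add_le_add_right hab a))
        · exact Or.inr ⟨x', hx, hxg, hxl.trans (add_le_add_right hab a)⟩
      have ht : C.tog (C.nx I a) L ≠ some w := by
        intro ht
        apply htog
        simp only [tog]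
        rw [if_pos ha, if_pos hfa, ht]
        simp
      rcases ih _ (hW.tail C) hup' hnl ht with h1 | ⟨h1, h2⟩
      · left
        have := C.add_lt a h1
        simpa [add_comm] using this
      · right
        refine ⟨by simp [h1], ?_⟩
        simp only [code]
        rw [if_pos ha, if_pos hfa, if_pos ha, if_pos hfa]
        exact Or.inr ⟨rfl, h2⟩
    · by_cases hs : C.lt L'.sum L.sum
      · left
        have := C.add_lt a hs
        simpa [add_comm] using this
      · right
        have hle : C.le L'.sum L.sum := by
          clear ih hW hnl htog hs
          induction h with
          | here a b L =>
            have := C.add_le L.sum (C.NF_le (a + b))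
            simpa [add_assoc] using this
          | there w a L L' h ih =>
            have := C.add_le a ih
            simpa [add_comm] using this
        have he : L'.sum = L.sum := by
          by_contra hne
          exact hs (C.lt_of_le_ne hle hne)
        refine ⟨by simp [he], ?_⟩
        simp only [code]
        rw [if_neg ha, if_neg ha]
        left
        show _ < _
        have := h.length
        omega

/-- The toggle pairs up words. -/
theorem pair {d : ℕ} (hDB : C.DB d) : ∀ (L : List (Mon n)) (I : Set (Mon n)) (v : M e),
    C.Va d I → C.WF L → (∀ a, L.head? = some a → a ∈ I) → C.tog I L = some v →
    ∃ U D, C.Mrg v U D ∧ (L = U ∨ L = D) ∧ C.code I U = C.code I D ∧ U.sum = D.sum ∧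
      C.tog I U = some v ∧ C.tog I D = some v ∧ C.WF U ∧ C.WF D ∧ C.nl I U
  | [], I, v => by
    intro _ _ _ h
    simp [tog] at h
  | a :: L, I, v => by
    intro hI hW hh ht
    have ha : a ∈ I := hh a rfl
    have hsa : C.St a := (hW a (by simp)).2
    obtain ⟨f1, f2, f3⟩ := C.fs_spec ha
    by_cases hfa : a = C.fs I a
    · simp only [tog] at ht
      rw [if_pos ha, if_pos hfa] at ht
      cases L with
      | nil => simp [tog] at ht
      | cons b L =>
        by_cases hb : b ∈ C.nx I a
        · obtain ⟨u, hu, rfl⟩ := Option.map_eq_some_iff.mp ht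
          have hI' : C.Va d (C.nx I a) := by
            have := hI.next C hDB ha hsa
            rwa [← hfa] at this
          obtain ⟨U, D, k1, k2, k3, k4, k5, k6, k7, k8, k9⟩ :=
            pair hDB (b :: L) (C.nx I a) u hI' (hW.tail C) (by simpa using hb) hu
          have hta : ∀ X, C.tog (C.nx I a) X = some u → C.tog I (a :: X) = some (C.ph a + u) := by
            intro X hX
            simp only [tog]
            rw [if_pos ha, if_pos hfa, hX]; rfl
          refine ⟨a :: U, a :: D, Mrg.there _ _ _ _ k1, ?_, ?_, ?_, hta U k5, hta D k6,
            WF.cons C (hW a (by simp)).1 hsa k7, WF.cons C (hW a (by simp)).1 hsa k8,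
            Or.inr ⟨hfa, k9⟩⟩
          · rcases k2 with k2 | k2
            · left; rw [k2]
            · right; rw [k2]
          · simp only [code]
            rw [if_pos ha, if_pos hfa, if_pos ha, if_pos hfa, k3]
          · simp [k4]
        · have hv : v = C.ph a := by
            simp only [tog] at ht
            rw [if_neg hb] at ht
            simpa using ht.symm
          have hst : C.St (a + b) := by
            by_contra h; exact hb (Or.inl h)
          have hab : a + b ∈ I := hI.1 a ha _ le_self_add
          have hfab : C.fs I (a + b) = a := by
            obtain ⟨g1, g2, g3⟩ := C.fs_spec hab
            refine C.le_antisymm (g3 a ha le_self_add) ?_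
            by_contra hc
            exact hb (Or.inr ⟨_, g1, C.not_le.mp hc, g2⟩)
          have hb0 : b ≠ 0 := (hW b (by simp)).1
          have hne : a + b ≠ C.fs I (a + b) := by
            rw [hfab]; simpa using hb0
          have hab0 : a + b ≠ 0 := by
            intro h0; rw [h0] at hab; exact hI.2.1 hab
          refine ⟨a :: b :: L, (a + b) :: L, ?_, Or.inl rfl, ?_, ?_, ?_, ?_, hW,
            WF.cons C hab0 hst ((hW.tail C).tail C), Or.inr ⟨hfa, Or.inl hb⟩⟩
          · have := Mrg.here (C := C) a b L
            rw [hst.NF C] at this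
            rw [hv]; exact this
          · simp only [code]
            rw [if_pos ha, if_pos hfa, if_neg hb, if_pos hab, if_neg hne, hfab]
          · simp [add_assoc]
          · simp only [tog]
            rw [if_pos ha, if_pos hfa, if_neg hb, hv]; simp
          · simp only [tog]
            rw [if_pos hab, if_neg hne, hfab, hv]
    · set g := C.fs I a with hg
      have hv : v = C.ph g := by
        simp only [tog] at ht
        rw [if_pos ha, if_neg hfa] at ht
        simpa using ht.symm
      have hgb : g + (a - g) = a := add_tsub_cancel_of_le f2
      have hfg : g = C.fs I g := by
        obtain ⟨g1, g2, g3⟩ := C.fs_spec f1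
        exact C.le_antisymm (f3 _ g1 (g2.trans f2)) (g3 g f1 (_root_.le_refl g))
      have hb : a - g ∉ C.nx I g := by
        rintro (h | ⟨x, hx, hxg, hxl⟩)
        · rw [hgb] at h; exact h hsa
        · rw [hgb] at hxl
          exact C.not_le.mpr hxg (f3 x hx hxl)
      have hb0 : a - g ≠ 0 := by
        intro h0; rw [h0, add_zero] at hgb; exact hfa hgb.symm
      have hg0 : g ≠ 0 := by
        intro h0; rw [h0] at f1; exact hI.2.1 f1
      refine ⟨g :: (a - g) :: L, a :: L, ?_, Or.inr rfl, ?_, ?_, ?_, ht, ?_, hW,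
        Or.inr ⟨hfg, Or.inl hb⟩⟩
      · have := Mrg.here (C := C) g (a - g) L
        rw [hgb, hsa.NF C] at this
        rw [hv]; exact this
      · simp only [code]
        rw [if_pos f1, if_pos hfg, if_neg hb, if_pos ha, if_neg hfa]
      · simp only [List.sum_cons, ← add_assoc, hgb]
      · simp only [tog]
        rw [if_pos f1, if_pos hfg, if_neg hb, hv]; simp
      · exact WF.cons C hg0 (hsa.mono C f2) (WF.cons C hb0 (hsa.mono C tsub_le_self) (hW.tail C))

theorem tog_none {d : ℕ} (hDB : C.DB d) : ∀ (L : List (Mon n)) (I : Set (Mon n)),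
    C.Va d I → C.WF L → C.tog I L = none →
    C.nl I L ∧ L.sum.degree + L.length ≤ d * L.length
  | [], I => by
    intro _ _ _
    simp [nl]
  | a :: L, I => by
    intro hI hW ht
    have hsa : C.St a := (hW a (by simp)).2
    simp only [tog] at ht
    by_cases ha : a ∈ I
    · rw [if_pos ha] at ht
      by_cases hfa : a = C.fs I a
      · rw [if_pos hfa] at ht
        have hI' : C.Va d (C.nx I a) := by
          have := hI.next C hDB ha hsa
          rwa [← hfa] at this
        obtain ⟨h1, h2⟩ := tog_none hDB L _ hI' (hW.tail C) (by simpa using ht)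
        refine ⟨Or.inr ⟨hfa, h1⟩, ?_⟩
        have := hI.fs_degree C ha hsa
        rw [← hfa] at this
        simp only [List.sum_cons, map_add, List.length_cons, mul_add]
        omega
      · rw [if_neg hfa] at ht; simp at ht
    · rw [if_neg ha] at ht; simp at ht

theorem tog_none_top {d : ℕ} (hd : 2 ≤ d) (hDB : C.DB d) (a : Mon n) (L : List (Mon n))
    (hW : C.WF (a :: L)) (ht : C.tog (I0 n) (a :: L) = none) :
    (a :: L).sum.degree + L.length ≤ 1 + d * L.length := by
  have hI := C.Va_I0 hd
  have hsa : C.St a := (hW a (by simp)).2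
  have ha : a ∈ I0 n := (hW a (by simp)).1
  simp only [tog] at ht
  rw [if_pos ha] at ht
  by_cases hfa : a = C.fs (I0 n) a
  · rw [if_pos hfa] at ht
    have hI' : C.Va d (C.nx (I0 n) a) := by
      have := hI.next C hDB ha hsa
      rwa [← hfa] at this
    obtain ⟨h1, h2⟩ := C.tog_none hDB L _ hI' (hW.tail C) (by simpa using ht)
    have := C.fs_I0 ha
    rw [← hfa] at this
    simp only [List.sum_cons, map_add]
    omega
  · rw [if_neg hfa] at ht; simp at ht

end Ct
end ASG

namespace ASG
open Metric Set
namespace Ct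

variable {e n : ℕ} (C : Ct e n)

/-- Proper partial sums of a word. -/
def F : List (Mon n) → Finset (M e)
  | [] => ∅
  | a :: L => if L = [] then ∅ else insert (C.ph a) ((F L).image (C.ph a + ·))

theorem F_cons {a : Mon n} {L : List (Mon n)} (h : L ≠ []) :
    C.F (a :: L) = insert (C.ph a) ((C.F L).image (C.ph a + ·)) := by
  simp only [F]; rw [if_neg h]

theorem F_one (a : Mon n) : C.F [a] = ∅ := by simp [F]

theorem ph_ne_zero {m : Mon n} (h : m ≠ 0) : C.ph m ≠ 0 := fun h' => h (C.ph_eq_zero h')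

/-- Faces between `0` and `lam`, in additive form. -/
def Fc (lam : M e) (S : Finset (M e)) : Prop :=
  (∀ μ ∈ S, μ ∈ sg C.α ∧ μ ≠ 0 ∧ ∃ δ ∈ sg C.α, δ ≠ 0 ∧ μ + δ = lam) ∧
    (S : Set (M e)).Pairwise (cmp2 C.α)

theorem Fc_iff (lam : M e) (S : Finset (M e)) : IsOFace C.α 0 lam S ↔ C.Fc lam S := by
  unfold IsOFace Fc
  refine and_congr (forall₂_congr fun μ hμ => ?_) Iff.rfl
  constructor
  · rintro ⟨h1, ⟨-, h2⟩, ⟨δ, hδ, h3⟩, h4⟩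
    refine ⟨h1, h2.symm, δ, hδ, ?_, h3⟩
    rintro rfl
    exact h4 (by simpa using h3)
  · rintro ⟨h1, h2, δ, hδ, h3, h4⟩
    refine ⟨h1, ⟨⟨μ, h1, zero_add _⟩, h2.symm⟩, ⟨δ, hδ, h4⟩, ?_⟩
    rintro rfl
    exact h3 (by simpa using h4)

theorem sum_ne_zero {L : List (Mon n)} (hW : C.WF L) (h : L ≠ []) : L.sum ≠ 0 := by
  cases L with
  | nil => exact absurd rfl h
  | cons a L =>
    rw [List.sum_cons]
    intro h0
    exact (hW a (by simp)).1 (add_eq_zero.mp h0).1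

theorem cmp2_add (x a b : M e) (h : cmp2 C.α a b) : cmp2 C.α (x + a) (x + b) := by
  rcases h with ⟨δ, hδ, h⟩ | ⟨δ, hδ, h⟩
  · exact Or.inl ⟨δ, hδ, by rw [add_assoc, h]⟩
  · exact Or.inr ⟨δ, hδ, by rw [add_assoc, h]⟩

theorem F_face : ∀ L : List (Mon n), C.WF L → C.Fc (C.ph L.sum) (C.F L)
  | [] => by intro _; simp [F, Fc]
  | a :: L => by
    intro hW
    by_cases hL : L = []
    · subst hL; rw [F_one]; simp [Fc]
    · have ih := F_face L (hW.tail C)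
      rw [C.F_cons hL]
      have ha := (hW a (by simp)).1
      refine ⟨?_, ?_⟩
      · intro μ hμ
        rcases Finset.mem_insert.mp hμ with rfl | hμ
        · refine ⟨C.ph_mem a, C.ph_ne_zero ha, C.ph L.sum, C.ph_mem _,
            C.ph_ne_zero (C.sum_ne_zero (hW.tail C) hL), ?_⟩
          rw [List.sum_cons, map_add]
        · obtain ⟨ν, hν, rfl⟩ := Finset.mem_image.mp hμ
          obtain ⟨h1, h2, δ, h3, h4, h5⟩ := ih.1 ν hν
          refine ⟨add_mem (C.ph_mem a) h1, ?_, δ, h3, h4, ?_⟩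
          · intro h0; exact h2 (add_eq_zero.mp h0).2
          · rw [List.sum_cons, map_add, ← h5, add_assoc]
      · rw [Finset.coe_insert, Finset.coe_image]
        refine Set.Pairwise.insert ?_ ?_
        · rintro _ ⟨x, hx, rfl⟩ _ ⟨y, hy, rfl⟩ hne
          exact C.cmp2_add _ _ _ (ih.2 hx hy (by rintro rfl; exact hne rfl))
        · rintro _ ⟨x, hx, rfl⟩ hne
          have hx' := (ih.1 x hx).1
          exact ⟨Or.inl ⟨x, hx', rfl⟩, Or.inr ⟨x, hx', rfl⟩⟩

theorem not_mem_im {x : M e} {L : List (Mon n)} (hW : C.WF L) :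
    x ∉ (C.F L).image (x + ·) := by
  intro h
  obtain ⟨y, hy, h⟩ := Finset.mem_image.mp h
  exact ((C.F_face L hW).1 y hy).2.1 (by simpa using h)

theorem F_card : ∀ L : List (Mon n), C.WF L → L ≠ [] → (C.F L).card + 1 = L.length
  | [] => by intro _ h; exact absurd rfl h
  | a :: L => by
    intro hW _
    by_cases hL : L = []
    · subst hL; simp [F_one]
    · have ih := F_card L (hW.tail C) hL
      rw [C.F_cons hL, Finset.card_insert_of_notMem (C.not_mem_im (hW.tail C)),
        Finset.card_image_of_injective _ (add_right_injective _), ih, List.length_cons]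

theorem F_inj : ∀ L1 L2 : List (Mon n), C.WF L1 → C.WF L2 → L1 ≠ [] → L2 ≠ [] →
    C.ph L1.sum = C.ph L2.sum → C.F L1 = C.F L2 → L1 = L2
  | [], _ => by intro _ _ h; exact absurd rfl h
  | _ :: _, [] => by intro _ _ _ h; exact absurd rfl h
  | a :: L1, b :: L2 => by
    intro h1 h2 _ _ hs hF
    have hlen : L1.length = L2.length := by
      have k1 := C.F_card _ h1 (by simp)
      have k2 := C.F_card _ h2 (by simp)
      rw [hF] at k1
      simp only [List.length_cons] at k1 k2
      omega
    have hsa := (h1 a (by simp)).2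
    have hsb := (h2 b (by simp)).2
    by_cases hL1 : L1 = []
    · subst hL1
      have hL2 : L2 = [] := List.length_eq_zero_iff.mp hlen.symm
      subst hL2
      have : a = b := hsa.eq C hsb (by simpa using hs)
      rw [this]
    · have hL2 : L2 ≠ [] := by
        intro h; rw [h] at hlen; exact hL1 (List.length_eq_zero_iff.mp hlen)
      rw [C.F_cons hL1, C.F_cons hL2] at hF
      have hab : C.ph a = C.ph b := by
        have m1 : C.ph a ∈ insert (C.ph b) ((C.F L2).image (C.ph b + ·)) := by
          rw [← hF]; exact Finset.mem_insert_self _ _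
        have m2 : C.ph b ∈ insert (C.ph a) ((C.F L1).image (C.ph a + ·)) := by
          rw [hF]; exact Finset.mem_insert_self _ _
        rcases Finset.mem_insert.mp m1 with h | h
        · exact h
        · rcases Finset.mem_insert.mp m2 with h' | h'
          · exact h'.symm
          · obtain ⟨x, hx, h⟩ := Finset.mem_image.mp h
            obtain ⟨y, hy, h'⟩ := Finset.mem_image.mp h'
            rw [← h, add_assoc] at h'
            have h0 : x + y = 0 := by simpa using h'
            exact absurd (add_eq_zero.mp h0).1 ((C.F_face L2 (h2.tail C)).1 x hx).2.1
      have hab' : a = b := hsa.eq C hsb hab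
      subst hab'
      have he := congrArg (fun S => S.erase (C.ph a)) hF
      rw [Finset.erase_insert (C.not_mem_im (h1.tail C)),
        Finset.erase_insert (C.not_mem_im (h2.tail C))] at he
      have he' := Finset.image_injective (add_right_injective _) he
      rw [F_inj L1 L2 (h1.tail C) (h2.tail C) hL1 hL2 ?_ he']
      simpa using hs

theorem Mrg.F {w : M e} {L L' : List (Mon n)} (h : C.Mrg w L L') : C.WF L →
    w ∈ C.F L ∧ C.F L' = (C.F L).erase w ∧ C.WF L' ∧ C.ph L'.sum = C.ph L.sum ∧ L' ≠ [] := by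
  induction h with
  | here a b L =>
    intro hW
    have ha := hW a (by simp)
    have hb := hW b (by simp)
    rw [C.F_cons (a := a) (L := b :: L) (by simp)]
    refine ⟨Finset.mem_insert_self _ _, ?_, ?_, ?_, by simp⟩
    · rw [Finset.erase_insert (C.not_mem_im (hW.tail C))]
      by_cases hL : L = []
      · subst hL; simp [F_one]
      · rw [C.F_cons hL, C.F_cons hL, Finset.image_insert, Finset.image_image, C.ph_NF, map_add]
        congr 1
        refine Finset.image_congr ?_
        intro x _
        simp [add_assoc]
    · refine WF.cons C (C.NF_ne_zero ?_) (C.St_NF _) ((hW.tail C).tail C)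
      intro h0; exact ha.1 (add_eq_zero.mp h0).1
    · simp [C.ph_NF, add_assoc]
  | there w a L L' h ih =>
    intro hW
    have ha := hW a (by simp)
    obtain ⟨h1, h2, h3, h4, h5⟩ := ih (hW.tail C)
    have hL : L ≠ [] := by
      rintro rfl; cases h
    rw [C.F_cons hL, C.F_cons h5]
    have hw := ((C.F_face L (hW.tail C)).1 w h1).2.1
    refine ⟨Finset.mem_insert_of_mem (Finset.mem_image_of_mem _ h1), ?_,
      WF.cons C ha.1 ha.2 h3, ?_, by simp⟩
    · rw [h2, Finset.erase_insert_of_ne (by simpa using hw),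
        Finset.image_erase (add_right_injective _)]
    · simp [h4]

theorem exists_Mrg : ∀ (L : List (Mon n)) (w : M e), w ∈ C.F L → ∃ L', C.Mrg w L L'
  | [], w => by intro h; simp [Ct.F] at h
  | [a], w => by intro h; simp [F_one] at h
  | a :: b :: L, w => by
    intro h
    rw [C.F_cons (by simp)] at h
    rcases Finset.mem_insert.mp h with rfl | h
    · exact ⟨_, Mrg.here a b L⟩
    · obtain ⟨x, hx, rfl⟩ := Finset.mem_image.mp h
      obtain ⟨L', hL'⟩ := exists_Mrg (b :: L) x hx
      exact ⟨_, Mrg.there _ _ _ _ hL'⟩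

theorem F_surj (N : ℕ) : ∀ (S : Finset (M e)) (lam : M e), S.card = N → lam ∈ sg C.α → lam ≠ 0 →
    C.Fc lam S → ∃ L, C.WF L ∧ L ≠ [] ∧ C.ph L.sum = lam ∧ C.F L = S := by
  induction N with
  | zero =>
    intro S lam hS hl h0 _
    rw [Finset.card_eq_zero] at hS
    subst hS
    obtain ⟨m, rfl⟩ := C.exists_ph hl
    refine ⟨[C.NF m], ?_, by simp, by simp [C.ph_NF], C.F_one _⟩
    refine WF.cons C (C.NF_ne_zero ?_) (C.St_NF m) (fun a h => absurd h (by simp))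
    rintro rfl
    exact h0 (map_zero _)
  | succ N ih =>
    intro S lam hS hl h0 hF
    have hne : S.Nonempty := Finset.card_pos.mp (by omega)
    obtain ⟨μ, hμ, hmin⟩ := Finset.exists_min_image S (fun x => x.degree) hne
    obtain ⟨hμs, hμ0, δ, hδ, hδ0, hδe⟩ := hF.1 μ hμ
    have hge : ∀ ν ∈ S, ν ≠ μ → ∃ ε ∈ sg C.α, ε ≠ 0 ∧ μ + ε = ν := by
      intro ν hν hνμ
      rcases hF.2 hμ hν hνμ.symm with ⟨ε, hε, h⟩ | ⟨ε, hε, h⟩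
      · refine ⟨ε, hε, ?_, h⟩
        rintro rfl
        exact hνμ (by simpa using h.symm)
      · exfalso
        have h1 := hmin ν hν
        have h2 := congrArg Finsupp.degree h
        rw [map_add] at h2
        have h3 : ε.degree = 0 := by omega
        rw [Finsupp.degree_eq_zero_iff] at h3
        rw [h3, add_zero] at h
        exact hνμ h
    set T := (S.erase μ).image (fun x => x - μ) with hT
    have hTm : ∀ x ∈ T, μ + x ∈ S ∧ x ∈ sg C.α ∧ x ≠ 0 := by
      intro x hx
      obtain ⟨ν, hν, rfl⟩ := Finset.mem_image.mp hx
      have hν' := Finset.mem_erase.mp hν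
      obtain ⟨ε, hε, hε0, rfl⟩ := hge ν hν'.2 hν'.1
      simp only [add_tsub_cancel_left]
      exact ⟨hν'.2, hε, hε0⟩
    have himg : T.image (μ + ·) = S.erase μ := by
      rw [hT, Finset.image_image]
      conv_rhs => rw [← Finset.image_id (s := S.erase μ)]
      refine Finset.image_congr ?_
      intro ν hν
      have hν' := Finset.mem_erase.mp hν
      obtain ⟨ε, hε, hε0, rfl⟩ := hge ν hν'.2 hν'.1
      simp
    have hTc : T.card = N := by
      have := Finset.card_image_of_injective T (add_right_injective μ)
      rw [himg, Finset.card_erase_of_mem hμ, hS] at this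
      omega
    have hTF : C.Fc δ T := by
      refine ⟨?_, ?_⟩
      · intro x hx
        obtain ⟨h1, h2, h3⟩ := hTm x hx
        obtain ⟨-, -, η, k1, k2, k3⟩ := hF.1 _ h1
        refine ⟨h2, h3, η, k1, k2, ?_⟩
        rw [← hδe, add_assoc] at k3
        exact add_left_cancel k3
      · intro x hx y hy hne
        have hx' := (hTm x hx).1
        have hy' := (hTm y hy).1
        rcases hF.2 hx' hy' (by simpa using hne) with ⟨ε, hε, h⟩ | ⟨ε, hε, h⟩
        · rw [add_assoc] at h
          exact Or.inl ⟨ε, hε, add_left_cancel h⟩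
        · rw [add_assoc] at h
          exact Or.inr ⟨ε, hε, add_left_cancel h⟩
    obtain ⟨L, hW, hL, hsum, hFL⟩ := ih T δ hTc hδ hδ0 hTF
    obtain ⟨m, rfl⟩ := C.exists_ph hμs
    refine ⟨C.NF m :: L, WF.cons C (C.NF_ne_zero ?_) (C.St_NF m) hW, by simp, ?_, ?_⟩
    · rintro rfl
      exact hμ0 (map_zero _)
    · rw [List.sum_cons, map_add, hsum, C.ph_NF, hδe]
    · rw [C.F_cons hL, C.ph_NF, hFL, himg, Finset.insert_erase hμ]

end Ct
end ASG

namespace ASG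
open Metric Set
namespace Ct

variable {e n : ℕ} (C : Ct e n)

theorem aeval_mon (k : Type) [Field k] (m : Mon n) (c : k) :
    MvPolynomial.aeval (R := k)
      (fun i : Fin n => (MvPolynomial.monomial (C.α i) 1 : MvPolynomial (Fin e) k))
      (MvPolynomial.monomial m c) = MvPolynomial.monomial (C.ph m) c := by
  rw [MvPolynomial.aeval_monomial]
  have : (m.prod fun i j => (MvPolynomial.monomial (C.α i) 1 : MvPolynomial (Fin e) k) ^ j)
      = MvPolynomial.monomial (C.ph m) 1 := by
    rw [ph, Finsupp.linearCombination_apply, Finsupp.sum, Finsupp.prod,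
      MvPolynomial.monomial_sum_one]
    refine Finset.prod_congr rfl fun i _ => ?_
    rw [MvPolynomial.monomial_pow, one_pow]
  rw [this, MvPolynomial.algebraMap_eq, MvPolynomial.C_mul_monomial, mul_one]

theorem aeval_coeff (k : Type) [Field k] (f : MvPolynomial (Fin n) k) (x : M e) :
    MvPolynomial.coeff x (MvPolynomial.aeval (R := k)
      (fun i : Fin n => (MvPolynomial.monomial (C.α i) 1 : MvPolynomial (Fin e) k)) f) =
      ∑ m ∈ f.support, if C.ph m = x then MvPolynomial.coeff m f else 0 := by
  conv_lhs => rw [f.as_sum]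
  rw [map_sum, MvPolynomial.coeff_sum]
  refine Finset.sum_congr rfl fun m _ => ?_
  rw [aeval_mon, MvPolynomial.coeff_monomial]

theorem DB_of_GB (k : Type) [Field k] {d : ℕ} (h : HasGB k C.ord C.α d) : C.DB d := by
  obtain ⟨G, hG, hspan⟩ := h
  intro m hm
  have hlead : ∀ f ∈ toricIdeal k C.α, ∀ mo ∈ f.support, (∀ m' ∈ f.support, C.le m' mo) →
      ¬ C.St mo := by
    intro f hf mo hmo hmax hst
    have h0 : MvPolynomial.coeff (C.ph mo) (MvPolynomial.aeval (R := k)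
      (fun i : Fin n => (MvPolynomial.monomial (C.α i) 1 : MvPolynomial (Fin e) k)) f) = 0 := by
      have : MvPolynomial.aeval (R := k)
        (fun i : Fin n => (MvPolynomial.monomial (C.α i) 1 : MvPolynomial (Fin e) k)) f = 0 := hf
      rw [this, MvPolynomial.coeff_zero]
    rw [aeval_coeff, Finset.sum_eq_single_of_mem mo hmo] at h0
    · rw [if_pos rfl] at h0
      exact (MvPolynomial.mem_support_iff.mp hmo) h0
    · intro b hb hne
      rw [if_neg]
      intro hph
      exact hne (C.le_antisymm (hmax b hb) (hst b hph))
  have hmem : (MvPolynomial.monomial m 1 : MvPolynomial (Fin n) k) ∈ initialIdeal k C.ord C.α := by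
    refine Ideal.subset_span ⟨MvPolynomial.monomial m 1 - MvPolynomial.monomial (C.NF m) 1,
      ?_, ?_, m, ⟨?_, ?_⟩, rfl⟩
    · show MvPolynomial.aeval (R := k) _ _ = 0
      rw [map_sub, aeval_mon, aeval_mon, ph_NF, sub_self]
    · intro h0
      have := congrArg (MvPolynomial.coeff m) h0
      have hne : C.NF m ≠ m := fun h => hm (h ▸ C.St_NF m)
      simp [MvPolynomial.coeff_monomial, hne] at this
    · have hne : C.NF m ≠ m := fun h => hm (h ▸ C.St_NF m)
      simp [MvPolynomial.mem_support_iff, MvPolynomial.coeff_monomial, hne]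
    · intro m' hm'
      rw [MvPolynomial.mem_support_iff, MvPolynomial.coeff_sub, MvPolynomial.coeff_monomial,
        MvPolynomial.coeff_monomial] at hm'
      show C.le m' m
      by_cases h1 : m = m'
      · rw [h1]; exact C.le_refl _
      · by_cases h2 : C.NF m = m'
        · rw [← h2]; exact C.NF_le m
        · simp [h1, h2] at hm'
  rw [← hspan, MvPolynomial.mem_ideal_span_monomial_image] at hmem
  obtain ⟨h, hhG, hle⟩ := hmem m (by simp [MvPolynomial.mem_support_iff])
  refine ⟨h, hle, ?_, ?_⟩
  · have hh : (MvPolynomial.monomial h 1 : MvPolynomial (Fin n) k) ∈ initialIdeal k C.ord C.α := by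
      rw [← hspan]; exact Ideal.subset_span ⟨h, hhG, rfl⟩
    have himg : initialIdeal k C.ord C.α = Ideal.span
        ((fun mo => (MvPolynomial.monomial mo 1 : MvPolynomial (Fin n) k)) ''
          {mo | ∃ f ∈ toricIdeal k C.α, mo ∈ f.support ∧ ∀ m' ∈ f.support, C.le m' mo}) := by
      unfold initialIdeal
      congr 1
      ext p
      constructor
      · rintro ⟨f, hf, -, mo, ⟨h1, h2⟩, rfl⟩
        exact ⟨mo, ⟨f, hf, h1, h2⟩, rfl⟩
      · rintro ⟨mo, ⟨f, hf, h1, h2⟩, rfl⟩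
        refine ⟨f, hf, ?_, mo, ⟨h1, h2⟩, rfl⟩
        rintro rfl
        simp at h1
    rw [himg, MvPolynomial.mem_ideal_span_monomial_image] at hh
    obtain ⟨mo, ⟨f, hf, h1, h2⟩, hle'⟩ := hh h (by simp [MvPolynomial.mem_support_iff])
    intro hst
    exact hlead f hf mo h1 h2 (hst.mono C hle')
  · exact hG h hhG

end Ct
end ASG

namespace ASG
open Metric Set
namespace Ct

variable {e n : ℕ} (C : Ct e n)

theorem exists_word (m : Mon n) : ∃ w : Fin m.degree → Fin n, C.ph m = ∑ t, C.α (w t) := by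
  induction m using Finsupp.induction_linear with
  | zero =>
    rw [map_zero, map_zero]
    exact ⟨Fin.elim0, by simp⟩
  | add a b ha hb =>
    obtain ⟨u, hu⟩ := ha
    obtain ⟨v, hv⟩ := hb
    rw [map_add, map_add]
    refine ⟨Fin.append u v, ?_⟩
    rw [Fin.sum_univ_add, hu, hv]
    simp
  | single i c =>
    rw [Finsupp.degree_single, ph_single]
    exact ⟨fun _ => i, by simp⟩

theorem deg_le (m : Mon n) : deg C.α (C.ph m) ≤ m.degree := Nat.sInf_le (C.exists_word m)

/-- Words encoding faces. -/
def Gd (lam : M e) (L : List (Mon n)) : Prop := C.WF L ∧ L ≠ [] ∧ C.ph L.sum = lam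

/-- The word of a face. -/
def wd (lam : M e) (S : Finset (M e)) : List (Mon n) :=
  if h : ∃ L, C.Gd lam L ∧ C.F L = S then h.choose else []

theorem wd_F {lam : M e} {L : List (Mon n)} (h : C.Gd lam L) : C.wd lam (C.F L) = L := by
  have hex : ∃ L', C.Gd lam L' ∧ C.F L' = C.F L := ⟨L, h, rfl⟩
  unfold wd
  rw [dif_pos hex]
  obtain ⟨h1, h2⟩ := hex.choose_spec
  exact C.F_inj _ _ h1.1 h.1 h1.2.1 h.2.1 (h1.2.2.trans h.2.2.symm) h2

/-- Rank of a word. -/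
def rkw (L : List (Mon n)) : Rk C := ⟨Sum.inl L.sum :: C.code (I0 n) L⟩

/-- All faces. -/
def Ks (lam : M e) : Finset (Finset (M e)) :=
  (Finset.Iic lam).powerset.filter fun S => IsOFace C.α 0 lam S

theorem mem_Ks {lam : M e} {S : Finset (M e)} : S ∈ C.Ks lam ↔ IsOFace C.α 0 lam S := by
  unfold Ks
  rw [Finset.mem_filter, Finset.mem_powerset]
  refine ⟨fun h => h.2, fun h => ⟨fun μ hμ => ?_, h⟩⟩
  obtain ⟨-, -, ⟨δ, -, h⟩, -⟩ := h.1 μ hμ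
  rw [Finset.mem_Iic, ← h]
  exact le_self_add

theorem rk_less {d : ℕ} (hd : 2 ≤ d) {lam : M e} {L : List (Mon n)} (h : C.Gd lam L)
    (hnl : C.nl (I0 n) L) {w : M e} (hw : w ∈ C.F L) (ht : C.tog (I0 n) L ≠ some w) :
    C.rkw (C.wd lam ((C.F L).erase w)) < C.rkw (C.wd lam (C.F L)) := by
  obtain ⟨L', hL'⟩ := C.exists_Mrg L w hw
  obtain ⟨-, h2, h3, h4, h5⟩ := hL'.F C h.1
  rw [← h2, C.wd_F h, C.wd_F ⟨h3, h5, h4.trans h.2.2⟩]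
  refine C.rk_lt ?_
  rcases hL'.less C (I0 n) h.1 (C.Va_I0 hd).1 hnl ht with k | ⟨k1, k2⟩
  · exact Or.inl k
  · exact Or.inr ⟨by rw [k1], k2⟩

theorem main_NC {d q : ℕ} (hd : 2 ≤ d) (hDB : C.DB d) {lam : M e} (hl : lam ∈ sg C.α)
    (h0 : lam ≠ 0) (hq : ∀ c : ℕ, deg C.α lam + c ≤ 1 + d * c → q ≤ c) :
    NC q (Rl (C.Ks lam : Set (Finset (M e)))) := by
  refine NC.morse_dec (ρ := fun S => C.rkw (C.wd lam S)) (tg := fun S => C.tog (I0 n) (C.wd lam S))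
    (C.Ks lam) ⟨∅, ?_⟩ ?_ ?_
  · rw [mem_Ks]; simp [IsOFace]
  · intro S hS T hT
    rw [mem_Ks] at hS ⊢
    exact ⟨fun μ hμ => hS.1 μ (hT hμ), hS.2.mono (Finset.coe_subset.mpr hT)⟩
  · intro S hS
    rw [mem_Ks, Fc_iff] at hS
    obtain ⟨L, h1, h2, h3, rfl⟩ := C.F_surj _ S lam rfl hl h0 hS
    have hG : C.Gd lam L := ⟨h1, h2, h3⟩
    refine ⟨fun ht => ?_, fun v ht => ?_⟩
    · simp only [C.wd_F hG] at ht
      obtain ⟨k1, -⟩ := C.tog_none hDB L _ (C.Va_I0 hd) h1 ht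
      refine ⟨?_, fun w hw => C.rk_less hd hG k1 hw (by rw [ht]; simp)⟩
      cases L with
      | nil => exact absurd rfl h2
      | cons a L =>
        have k2 := C.tog_none_top hd hDB a L h1 ht
        have k3 := C.F_card _ h1 h2
        have k4 := C.deg_le (a :: L).sum
        rw [h3] at k4
        simp only [List.length_cons] at k3
        have k5 : (C.F (a :: L)).card = L.length := by omega
        rw [k5]
        refine hq _ ?_
        omega
    · simp only [C.wd_F hG] at ht
      obtain ⟨U, D, m1, m2, m3, m4, m5, m6, m7, m8, m9⟩ := C.pair hDB L (I0 n) v (C.Va_I0 hd) h1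
        (by
          intro a ha
          exact (h1 a (List.mem_of_mem_head? ha)).1) ht
      obtain ⟨f1, f2, f3, f4, f5⟩ := m1.F C m7
      have hUne : U ≠ [] := by rintro rfl; cases m1
      have hUl : C.ph U.sum = lam := by
        rcases m2 with rfl | rfl
        · exact h3
        · rw [m4]; exact h3
      have hGU : C.Gd lam U := ⟨m7, hUne, hUl⟩
      have hGD : C.Gd lam D := ⟨m8, f5, f4.trans hUl⟩
      have hi : insert v (C.F L) = C.F U := by
        rcases m2 with rfl | rfl
        · exact Finset.insert_eq_of_mem f1
        · rw [f2, Finset.insert_erase f1]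
      have hee : (C.F L).erase v = C.F D := by
        rcases m2 with rfl | rfl
        · exact f2.symm
        · rw [f2, Finset.erase_idem]
      have hrk : C.rkw U = C.rkw D := by
        unfold rkw
        rw [m3, m4]
      have hLr : C.rkw L = C.rkw D := by
        rcases m2 with rfl | rfl
        · exact hrk
        · rfl
      rw [hi, hee]
      simp only [C.wd_F hGU, C.wd_F hGD, C.wd_F hG]
      refine ⟨?_, m5, m6, hrk.trans hLr.symm, hLr.symm, ?_⟩
      · rw [mem_Ks, Fc_iff, ← hUl]
        exact C.F_face U m7
      · intro hv w hw hwv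
        have hLU : L = U := by
          rcases m2 with h | h
          · exact h
          · exfalso
            rw [h, f2] at hv
            simp at hv
        subst hLU
        have := C.rk_less hd hG m9 hw (by rw [m5]; simpa using hwv.symm)
        rwa [C.wd_F hG] at this

end Ct
end ASG

namespace ASG
open Metric Set

/-- Affine clamp `[-1,1] → [0,1]`. -/
def clp (s : ℝ) : unitInterval := Set.projIcc 0 1 zero_le_one ((s + 1) / 2)

theorem continuous_clp : Continuous clp := by
  unfold clp
  exact continuous_projIcc.comp (by fun_prop)

theorem clp_inv (s : unitInterval) : clp (2 * (s : ℝ) - 1) = s := by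
  unfold clp
  have : (2 * (s : ℝ) - 1 + 1) / 2 = s := by ring
  rw [this]
  exact Set.projIcc_val _ s

theorem clp_neg_one : clp (-1) = 0 := by
  have := clp_inv 0
  simpa using this

theorem clp_one : clp 1 = 1 := by
  have := clp_inv 1
  norm_num at this
  exact this

theorem NC.nonempty {V : Type} {X : Set (V → ℝ)} {c : ℕ} (h : NC c X) (hc : 0 < c) :
    X.Nonempty := by
  have hs : Metric.sphere (0 : Fin 0 → ℝ) 1 = ∅ := by
    refine eq_empty_of_forall_notMem fun y hy => ?_
    have h1 : ‖y‖ = 1 := mem_sphere_zero_iff_norm.mp hy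
    rw [Subsingleton.elim y 0, norm_zero] at h1
    exact zero_ne_one h1
  obtain ⟨g, -, hg, -⟩ := h (Fin 0) (by simpa using hc) (fun _ => 0) continuousOn_const
    (by rw [hs]; exact mapsTo_empty _ _)
  exact ⟨g 0, hg (by simp)⟩

theorem NC.homotopyGroup {V : Type} {P : (V → ℝ) → Prop} {c j : ℕ} (h : NC c {f | P f})
    (hj : j + 1 < c) (p : {f // P f}) : Subsingleton (HomotopyGroup (Fin j) {f // P f} p) := by
  refine ⟨fun a b => ?_⟩
  induction a using Quotient.inductionOn with
  | _ f =>
  induction b using Quotient.inductionOn with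
  | _ g =>
  refine Quotient.sound ?_
  show GenLoop.Homotopic f g
  set T : (Fin (j + 1) → ℝ) → (Fin j → unitInterval) := fun y i => clp (y i.succ) with hT
  have hTc : Continuous T := continuous_pi fun i => continuous_clp.comp (continuous_apply _)
  set F : (Fin (j + 1) → ℝ) → (V → ℝ) := fun y =>
    if y 0 = -1 then (f.1 (T y)).1 else if y 0 = 1 then (g.1 (T y)).1 else p.1 with hF
  set S : Set (Fin (j + 1) → ℝ) := Metric.sphere 0 1 with hS
  have hbd : ∀ y, (∃ i : Fin j, y i.succ = 1 ∨ y i.succ = -1) → T y ∈ Cube.boundary (Fin j) := by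
    rintro y ⟨i, hi⟩
    refine ⟨i, ?_⟩
    rcases hi with hi | hi
    · right; simp only [hT, hi, clp_one]
    · left; simp only [hT, hi, clp_neg_one]
  have hp : ∀ y, (∃ i : Fin j, y i.succ = 1 ∨ y i.succ = -1) → F y = p.1 := by
    intro y hy
    have hb := hbd y hy
    have e1 : f.1 (T y) = p := f.2 _ hb
    have e2 : g.1 (T y) = p := g.2 _ hb
    simp only [hF, e1, e2, ite_self]
  have hSc : IsClosed S := isClosed_sphere
  set A : Set (Fin (j + 1) → ℝ) := {y | y 0 = -1} with hA
  set B : Set (Fin (j + 1) → ℝ) := {y | y 0 = 1} with hB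
  set D : Set (Fin (j + 1) → ℝ) := {y | ∃ i : Fin j, y i.succ = 1 ∨ y i.succ = -1} with hD
  have hAc : IsClosed A := isClosed_eq (continuous_apply _) continuous_const
  have hBc : IsClosed B := isClosed_eq (continuous_apply _) continuous_const
  have hDc : IsClosed D := by
    have : D = ⋃ i : Fin j, {y : Fin (j + 1) → ℝ | y i.succ = 1 ∨ y i.succ = -1} := by
      ext y; simp [hD]
    rw [this]
    refine isClosed_iUnion_of_finite fun i => ?_
    exact (isClosed_eq (continuous_apply _) continuous_const).union
      (isClosed_eq (continuous_apply _) continuous_const)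
  have hcov : S ⊆ A ∪ (B ∪ D) := by
    intro y hy
    have hy1 : ‖y‖ = 1 := by simpa [hS] using hy
    by_contra hn
    have hlt : ∀ i, ‖y i‖ < 1 := by
      intro i
      refine lt_of_le_of_ne (hy1 ▸ norm_le_pi_norm y i) fun he => hn ?_
      rw [Real.norm_eq_abs] at he
      have he' : y i = 1 ∨ y i = -1 := by
        rcases abs_choice (y i) with h' | h' <;> rw [h'] at he
        · exact Or.inl he
        · right; linarith
      refine Fin.cases (motive := fun i => (y i = 1 ∨ y i = -1) → y ∈ A ∪ (B ∪ D)) ?_ ?_ i he'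
      · rintro (h' | h')
        · exact Or.inr (Or.inl h')
        · exact Or.inl h'
      · intro i h'
        exact Or.inr (Or.inr ⟨i, h'⟩)
    have := (pi_norm_lt_iff (x := y) one_pos).mpr hlt
    linarith
  have hFA : ContinuousOn F A := by
    have h1 : Continuous fun y => (f.1 (T y)).1 :=
      continuous_subtype_val.comp (f.1.continuous.comp hTc)
    refine h1.continuousOn.congr fun y hy => ?_
    have hy' : y 0 = -1 := hy
    simp only [hF, if_pos hy']
  have hFB : ContinuousOn F B := by
    have h1 : Continuous fun y => (g.1 (T y)).1 :=
      continuous_subtype_val.comp (g.1.continuous.comp hTc)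
    refine h1.continuousOn.congr fun y hy => ?_
    have hy' : y 0 = 1 := hy
    have hy2 : ¬ y 0 = -1 := by rw [hy']; norm_num
    simp only [hF, if_neg hy2, if_pos hy']
  have hFD : ContinuousOn F D :=
    (continuousOn_const (c := p.1)).congr fun y hy => hp y hy
  have hFc : ContinuousOn F S :=
    (hFA.union_of_isClosed (hFB.union_of_isClosed hFD hBc hDc) hAc (hBc.union hDc)).mono hcov
  have hFX : MapsTo F S {f | P f} := by
    intro y _
    show P (F y)
    simp only [hF]
    split_ifs
    · exact (f.1 (T y)).2
    · exact (g.1 (T y)).2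
    · exact p.2
  obtain ⟨G, hGc, hGX, hGF⟩ := h (Fin (j + 1)) (by simpa using hj) F hFc hFX
  set Y : unitInterval × (Fin j → unitInterval) → (Fin (j + 1) → ℝ) := fun z =>
    Fin.cons (2 * (z.1 : ℝ) - 1) (fun i => 2 * (z.2 i : ℝ) - 1) with hY
  have hYc : Continuous Y := by
    refine continuous_pi fun i => ?_
    refine Fin.cases ?_ (fun i => ?_) i
    · simp only [hY, Fin.cons_zero]; fun_prop
    · simp only [hY, Fin.cons_succ]
      have : Continuous fun a : unitInterval × (Fin j → unitInterval) => a.2 i :=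
        (continuous_apply i).comp continuous_snd
      fun_prop
  have hYabs : ∀ s : unitInterval, ‖2 * (s : ℝ) - 1‖ ≤ 1 := by
    intro s
    rw [Real.norm_eq_abs, abs_le]
    have := s.2.1
    have := s.2.2
    constructor <;> linarith
  have hYb : ∀ z, Y z ∈ closedBall (0 : Fin (j + 1) → ℝ) 1 := by
    intro z
    rw [mem_closedBall_zero_iff, pi_norm_le_iff_of_nonneg zero_le_one]
    intro i
    refine Fin.cases ?_ (fun i => ?_) i
    · simp only [hY, Fin.cons_zero]; exact hYabs _
    · simp only [hY, Fin.cons_succ]; exact hYabs _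
  have hYS : ∀ z i, (Y z i = 1 ∨ Y z i = -1) → Y z ∈ S := by
    intro z i hi
    rw [hS, mem_sphere_zero_iff_norm]
    refine le_antisymm (mem_closedBall_zero_iff.mp (hYb z)) ?_
    have := norm_le_pi_norm (Y z) i
    rcases hi with hi | hi <;> rw [hi] at this <;> simpa using this
  have hTY : ∀ z, T (Y z) = z.2 := by
    intro z
    funext i
    simp only [hT, hY, Fin.cons_succ, clp_inv]
  have hGYc : Continuous fun z => (⟨G (Y z), hGX (hYb z)⟩ : {f // P f}) := by
    refine Continuous.subtype_mk ?_ _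
    exact hGc.comp_continuous hYc hYb
  have hG0 : ∀ x, G (Y (0, x)) = (f.1 x).1 := by
    intro x
    have h0 : Y (0, x) 0 = -1 := by simp [hY]
    rw [hGF (hYS _ 0 (Or.inr h0))]
    simp only [hF, if_pos h0, hTY]
  have hG1 : ∀ x, G (Y (1, x)) = (g.1 x).1 := by
    intro x
    have h0 : Y (1, x) 0 = 1 := by simp [hY]; norm_num
    have h1 : ¬ Y (1, x) 0 = -1 := by rw [h0]; norm_num
    rw [hGF (hYS _ 0 (Or.inl h0))]
    simp only [hF, if_neg h1, if_pos h0, hTY]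
  refine ⟨⟨⟨⟨fun z => ⟨G (Y z), hGX (hYb z)⟩, hGYc⟩, ?_, ?_⟩, ?_⟩⟩
  · intro x
    exact Subtype.ext (hG0 x)
  · intro x
    exact Subtype.ext (hG1 x)
  · intro t x hx
    have hfx : f.1 x = p := f.2 x hx
    rw [show (f.1 : (Fin j → unitInterval) → {f // P f}) x = p from hfx]
    refine Subtype.ext ?_
    obtain ⟨i, hi⟩ := hx
    have hYi : Y (t, x) i.succ = 1 ∨ Y (t, x) i.succ = -1 := by
      simp only [hY, Fin.cons_succ]
      rcases hi with hi | hi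
      · right; rw [hi]; norm_num
      · left; rw [hi]; norm_num
    show G (Y (t, x)) = p.1
    rw [hGF (hYS _ _ hYi)]
    exact hp _ ⟨i, hYi⟩

theorem Geom_iff {e n : ℕ} (C : Ct e n) (lam : M e) :
    {f : M e → ℝ | (∀ μ, 0 ≤ f μ) ∧ ∃ S : Finset (M e), IsOFace C.α 0 lam S ∧ S.Nonempty ∧
        (∀ μ, f μ ≠ 0 → μ ∈ S) ∧ ∑ μ ∈ S, f μ = 1} = Rl (C.Ks lam : Set (Finset (M e))) := by
  ext f
  constructor
  · rintro ⟨h0, S, hS, -, h1, h2⟩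
    exact ⟨S, Finset.mem_coe.mpr (C.mem_Ks.mpr hS), h0, h1, h2⟩
  · rintro ⟨S, hS, h0, h1, h2⟩
    refine ⟨h0, S, C.mem_Ks.mp (Finset.mem_coe.mp hS), ?_, h1, h2⟩
    rw [Finset.nonempty_iff_ne_empty]
    rintro rfl
    simp at h2

end ASG

open ASG in
/-- If for some field `k` and some monomial term order `⪯`
the toric ideal `I_Λ` has a Gröbner basis of degree `d ≥ 2`, then for every
`λ ∈ Λ` with `deg λ > d` the geometric realization of `Δ(0,λ)` is nonempty and
path-connected, and all its homotopy groups `π_j` for `1 ≤ j < -1 + (deg λ - 1)/(d - 1)`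
are trivial; i.e. `Δ(0,λ)` is `j`-connected for every integer
`j < -1 + (deg λ - 1)/(d - 1)`. -/
theorem groebner_degree_bound_connectivity
    (e n : ℕ) (α : Fin n → M e) (hα : ∀ i, α i ≠ 0)
    (k : Type) [Field k] (ord : LinearOrder (Fin n →₀ ℕ)) (hord : IsTermOrder ord)
    (d : ℕ) (hd : 2 ≤ d) (hGB : HasGB k ord α d)
    (lam : M e) (hlam : lam ∈ sg α) (hdeg : d < deg α lam) :
    Nonempty (Geom α 0 lam) ∧ PathConnectedSpace (Geom α 0 lam) ∧
      ∀ j : ℕ, 1 ≤ j → (j : ℚ) < -1 + ((deg α lam : ℚ) - 1) / ((d : ℚ) - 1) →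
        ∀ p : Geom α 0 lam, Subsingleton (HomotopyGroup (Fin j) (Geom α 0 lam) p) := by
  let C : Ct e n := ⟨α, hα, ord, hord⟩
  have hDB : C.DB d := C.DB_of_GB k hGB
  have h0 : lam ≠ 0 := by
    rintro rfl
    have := C.deg_le 0
    rw [map_zero, map_zero] at this
    have h' : deg α 0 ≤ 0 := this
    omega
  have key : ∀ q : ℕ, (∀ c : ℕ, deg α lam + c ≤ 1 + d * c → q ≤ c) →
      NC q {f : M e → ℝ | (∀ μ, 0 ≤ f μ) ∧ ∃ S : Finset (M e), IsOFace α 0 lam S ∧ S.Nonempty ∧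
        (∀ μ, f μ ≠ 0 → μ ∈ S) ∧ ∑ μ ∈ S, f μ = 1} := by
    intro q hq
    have := C.main_NC (q := q) hd hDB hlam h0 hq
    rw [← Geom_iff C lam] at this
    exact this
  have h2 := key 2 (by
    intro c hc
    by_contra hlt
    have : c = 0 ∨ c = 1 := by omega
    rcases this with rfl | rfl <;> omega)
  have hne : Nonempty (Geom α 0 lam) := by
    obtain ⟨f, hf⟩ := h2.nonempty (by norm_num)
    exact ⟨⟨f, hf⟩⟩
  refine ⟨hne, ?_, ?_⟩
  · obtain ⟨p⟩ := hne
    have hs := h2.homotopyGroup (j := 0) (by norm_num) p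
    rw [pathConnectedSpace_iff_zerothHomotopy]
    refine ⟨⟨Quotient.mk _ p⟩, ?_⟩
    exact (HomotopyGroup.pi0EquivZerothHomotopy (X := Geom α 0 lam) (x := p)).symm.subsingleton
  · intro j _ hj p
    refine (key (j + 2) ?_).homotopyGroup (by omega) p
    intro c hc
    by_contra hlt
    have hc1 : (c : ℚ) ≤ j + 1 := by
      have : c ≤ j + 1 := by omega
      exact_mod_cast this
    have hcq : (deg α lam : ℚ) + c ≤ 1 + d * c := by exact_mod_cast hc
    have hd1 : (0 : ℚ) < (d : ℚ) - 1 := by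
      have : (2 : ℚ) ≤ d := by exact_mod_cast hd
      linarith
    have hj' : (j : ℚ) + 1 < ((deg α lam : ℚ) - 1) / ((d : ℚ) - 1) := by linarith
    rw [lt_div_iff₀ hd1] at hj'
    nlinarith
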